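/- Let 0 < p < 1 and let Z denote the space of entire functions f with ‖f‖_Z = ∫_ℂ e^{-π|Im z|} |Im z|^{1/p-2} |f(z)| dA(z) < ∞. Then E^p ⊆ Z, and for every f ∈ Z and every ε > 0 there exists g ∈ E^p with ‖f - g‖_Z < ε; that is, E^p is dense in Z in the norm ‖·‖_Z. -/

import Mathlib

open MeasureTheory Real Complex
open scoped ENNReal NNReal

/-- An entire function of exponential type `π`. -/
def ExpTypePi (f : ℂ → ℂ) : Prop :=
  Differentiable ℂ f ∧
    ∀ ε > 0, ∃ C > 0, ∀ z : ℂ, ‖f z‖ ≤ C * Real.exp ((Real.pi + ε) * ‖z‖)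

/-- The `Z`-norm `∫_ℂ e^{-π|Im z|} |Im z|^{1/p-2} |f(z)| dA(z)`. -/
noncomputable def ZNorm (p : ℝ) (f : ℂ → ℂ) : ℝ≥0∞ :=
  ∫⁻ z : ℂ, ENNReal.ofReal
      (Real.exp (-Real.pi * |z.im|) * |z.im| ^ (1 / p - 2)) * (‖f z‖₊ : ℝ≥0∞)

theorem submean_circle {F : ℂ → ℂ} {R s : ℝ} (hR : 0 < R) (hs : 0 < s)
    (hF : AnalyticOnNhd ℂ F (Metric.closedBall 0 R)) :
    ‖F 0‖ ^ s ≤ circleAverage (fun z => ‖F z‖ ^ s) 0 R := by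
  by_cases h0 : F 0 = 0
  · rw [h0, norm_zero, Real.zero_rpow hs.ne']
    apply circleAverage_nonneg_of_nonneg
    intro z _
    positivity
  have habs : |R| = R := abs_of_pos hR
  have hF' : AnalyticOnNhd ℂ F (Metric.closedBall 0 |R|) := by rwa [habs]
  have hcont : ContinuousOn (fun z => ‖F z‖ ^ s) (Metric.sphere 0 |R|) := by
    apply ContinuousOn.rpow_const
    · exact (hF'.continuousOn.mono Metric.sphere_subset_closedBall).norm
    · intro x _; right; exact hs.le
  have hne : ∀ᶠ x in Filter.codiscreteWithin (Metric.sphere (0:ℂ) |R|), F x ≠ 0 := by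
    apply Filter.codiscreteWithin_mono Metric.sphere_subset_closedBall
    rcases hF'.eqOn_zero_or_eventually_ne_zero_of_preconnected
      (convex_closedBall (0:ℂ) |R|).isPreconnected with h | h
    · exact absurd (h (by simp)) h0
    · exact h
  have hcongr : (fun z => ‖F z‖ ^ s) =ᶠ[Filter.codiscreteWithin (Metric.sphere (0:ℂ) |R|)]
      (fun z => Real.exp (s * Real.log ‖F z‖)) := by
    filter_upwards [hne] with z hz
    rw [Real.rpow_def_of_pos (norm_pos_iff.mpr hz), mul_comm]
  rw [circleAverage_congr_codiscreteWithin hcongr hR.ne']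
  have hI1 : CircleIntegrable (fun z => ‖F z‖ ^ s) 0 R := hcont.circleIntegrable'
  have hI2 : CircleIntegrable (fun z => Real.exp (s * Real.log ‖F z‖)) 0 R :=
    hI1.congr_codiscreteWithin hcongr
  have hL : CircleIntegrable (fun z => Real.log ‖F z‖) 0 R :=
    (hF'.mono Metric.sphere_subset_closedBall).meromorphicOn.circleIntegrable_log_norm
  have hlog : Real.log ‖F 0‖ ≤ circleAverage (fun z => Real.log ‖F z‖) 0 R := by
    rw [hF'.circleAverage_log_norm hR.ne' h0]
    have : 0 ≤ ∑ᶠ u, (MeromorphicOn.divisor F (Metric.closedBall 0 |R|) u : ℝ)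
        * Real.log (R * ‖0 - u‖⁻¹) := by
      apply finsum_nonneg
      intro u
      by_cases hu : u ∈ Metric.closedBall (0:ℂ) |R|
      · apply mul_nonneg
        · exact_mod_cast (MeromorphicOn.AnalyticOnNhd.divisor_nonneg hF') u
        · by_cases hu0 : u = 0
          · simp [hu0]
          apply Real.log_nonneg
          have : 0 < ‖u‖ := norm_pos_iff.mpr hu0
          simp only [zero_sub, norm_neg]
          rw [← div_eq_mul_inv, le_div_iff₀ this]
          simpa [habs] using hu
      · simp [hu]
    linarith
  set a := s * Real.log ‖F 0‖ with ha
  have hJ : CircleIntegrable (fun z => Real.exp a * (1 - a) + (Real.exp a * s) • Real.log ‖F z‖) 0 R :=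
    (circleIntegrable_const _ _ _).add (hL.const_fun_smul)
  have key := circleAverage_mono hJ hI2 (by
    intro z _
    have h1 := Real.add_one_le_exp (s * Real.log ‖F z‖ - a)
    have h2 : Real.exp (s * Real.log ‖F z‖) = Real.exp a * Real.exp (s * Real.log ‖F z‖ - a) := by
      rw [← Real.exp_add]; ring_nf
    simp only [smul_eq_mul]
    rw [h2]
    nlinarith [Real.exp_pos a])
  refine le_trans ?_ key
  rw [circleAverage_fun_add (circleIntegrable_const _ _ _) (hL.const_fun_smul), circleAverage_const,
    circleAverage_fun_smul]
  rw [Real.rpow_def_of_pos (norm_pos_iff.mpr h0), mul_comm, ← ha]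
  simp only [smul_eq_mul]
  have := Real.exp_pos a
  have h3 : a ≤ s * circleAverage (fun z => Real.log ‖F z‖) 0 R := by
    rw [ha]; gcongr
  nlinarith


theorem cayley_re_nonneg (z : ℂ) (hz : ‖z‖ ≤ 1) : 0 ≤ ((1 + z) / (1 - z)).re := by
  have h1 : z.re * z.re + z.im * z.im ≤ 1 := by
    have := Complex.sq_norm z
    rw [Complex.normSq_apply] at this
    nlinarith [norm_nonneg z]
  rw [Complex.div_re, ← add_div]
  apply div_nonneg _ (Complex.normSq_nonneg _)
  simp
  nlinarith

theorem cayley_re_pos (z : ℂ) (hz : ‖z‖ < 1) : 0 < ((1 + z) / (1 - z)).re := by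
  have h1 : z.re * z.re + z.im * z.im < 1 := by
    have := Complex.sq_norm z
    rw [Complex.normSq_apply] at this
    nlinarith [norm_nonneg z]
  have h2 : 1 - z ≠ 0 := by
    intro h
    have : z = 1 := by linear_combination -h
    simp [this] at hz
  rw [Complex.div_re, ← add_div]
  apply div_pos _ (Complex.normSq_pos.mpr h2)
  simp
  nlinarith

theorem cayley_angle (t : ℝ) :
    (1 + circleMap 0 1 (π - 2 * Real.arctan t)) / (1 - circleMap 0 1 (π - 2 * Real.arctan t))
      = t * I := by
  have hz : circleMap 0 1 (π - 2 * Real.arctan t) = (t * I - 1) / (t * I + 1) := by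
    have hne : (t * I + 1 : ℂ) ≠ 0 := by
      intro h
      have := congrArg Complex.re h
      simp at this
    have hpos : 0 < 1 + t ^ 2 := by positivity
    rw [circleMap, eq_div_iff hne]
    rw [Complex.ofReal_sub, Complex.ofReal_mul, Complex.ofReal_ofNat, Complex.ofReal_one]
    rw [show ((π : ℂ) - 2 * (Real.arctan t : ℂ)) * I
      = π * I + (-(Real.arctan t : ℂ) * I) + (-(Real.arctan t : ℂ) * I) by ring, Complex.exp_add,
      Complex.exp_add, Complex.exp_pi_mul_I]
    have h2 : Complex.exp (-(Real.arctan t : ℂ) * I) = (1 - t * I) * ((1 / √(1 + t ^ 2) : ℝ) : ℂ) := by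
      rw [Complex.exp_mul_I, Complex.cos_neg, Complex.sin_neg, ← Complex.ofReal_cos,
        ← Complex.ofReal_sin, Real.cos_arctan, Real.sin_arctan]
      push_cast
      ring
    rw [h2]
    have h3 : ((1 / √(1 + t ^ 2) : ℝ) : ℂ) * ((1 / √(1 + t ^ 2) : ℝ) : ℂ) = 1 / (1 + t ^ 2) := by
      rw [← Complex.ofReal_mul, div_mul_div_comm, Real.mul_self_sqrt hpos.le]
      push_cast; ring
    have hne' : (1 + t ^ 2 : ℂ) ≠ 0 := by exact_mod_cast hpos.ne'
    calc _ = -((1 - t * I) * (1 - t * I) * (t * I + 1)) *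
          (((1 / √(1 + t ^ 2) : ℝ) : ℂ) * ((1 / √(1 + t ^ 2) : ℝ) : ℂ)) := by push_cast; ring
      _ = _ := by
        rw [h3]
        field_simp
        linear_combination (1 - t * I) * (t : ℂ) ^ 2 * Complex.I_sq
  rw [hz]
  have hne : (t * I + 1 : ℂ) ≠ 0 := by
    intro h
    have := congrArg Complex.re h
    simp at this
  have : (1 - (t * I - 1) / (t * I + 1) : ℂ) = 2 / (t * I + 1) := by
    field_simp; ring
  rw [this]
  field_simp
  ring

theorem poisson_one {H : ℂ → ℂ} {M s : ℝ} (hs : 0 < s)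
    (hd : DiffContOnCl ℂ H {z | 0 < z.re}) (hb : ∀ z : ℂ, 0 ≤ z.re → ‖H z‖ ≤ M) :
    ENNReal.ofReal (‖H 1‖ ^ s) ≤
      ∫⁻ t : ℝ, ENNReal.ofReal (1 / (π * (1 + t ^ 2))) * ENNReal.ofReal (‖H (t * I)‖ ^ s) := by
  set F : ℂ → ℂ := fun z => H ((1 + z) / (1 - z)) with hF
  have hcl : closure {z : ℂ | 0 < z.re} = {z : ℂ | 0 ≤ z.re} := Complex.closure_setOfPred_lt_re 0
  have hHc : ContinuousOn H {z : ℂ | 0 ≤ z.re} := hcl ▸ hd.continuousOn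
  have hM : 0 ≤ M := (norm_nonneg _).trans (hb 1 (by simp))
  have hsub : ∀ R : ℝ, 0 < R → R < 1 → ‖H 1‖ ^ s ≤ circleAverage (fun z => ‖F z‖ ^ s) 0 R := by
    intro R hR0 hR1
    have : AnalyticOnNhd ℂ F (Metric.ball 0 1) := by
      apply DifferentiableOn.analyticOnNhd _ Metric.isOpen_ball
      apply hd.differentiableOn.comp (t := {z : ℂ | 0 < z.re})
      · intro z hz
        have : 1 - z ≠ 0 := by
          intro h
          have : z = 1 := by linear_combination -h
          simp [this] at hz
        apply DifferentiableAt.differentiableWithinAt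
        fun_prop (disch := assumption)
      · intro z hz
        exact cayley_re_pos z (by simpa using hz)
    have h := submean_circle hR0 hs (this.mono (Metric.closedBall_subset_ball hR1))
    simpa [hF] using h
  -- limit
  have hlim : Filter.Tendsto (fun R : ℝ => circleAverage (fun z => ‖F z‖ ^ s) 0 R)
      (nhdsWithin 1 (Set.Iio 1)) (nhds (circleAverage (fun z => ‖F z‖ ^ s) 0 1)) := by
    unfold circleAverage
    apply Filter.Tendsto.const_smul
    have hev : ∀ᶠ R in nhdsWithin (1:ℝ) (Set.Iio 1), 0 < R ∧ R < 1 := by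
      apply Filter.Eventually.and
      · exact nhdsWithin_le_nhds (lt_mem_nhds one_pos)
      · exact self_mem_nhdsWithin
    apply intervalIntegral.tendsto_integral_filter_of_dominated_convergence (fun _ => M ^ s)
    · filter_upwards [hev] with R hR
      apply Continuous.aestronglyMeasurable
      apply Continuous.rpow_const _ (fun _ => Or.inr hs.le)
      apply Continuous.norm
      apply hHc.comp_continuous
      · have : ∀ θ : ℝ, 1 - circleMap 0 R θ ≠ 0 := by
          intro θ h
          have h1 : circleMap 0 R θ = 1 := by linear_combination -h
          have h2 := norm_circleMap_zero R θ
          rw [h1, norm_one, abs_of_pos hR.1] at h2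
          linarith
        fun_prop (disch := assumption)
      · intro θ
        apply cayley_re_nonneg
        rw [norm_circleMap_zero, abs_of_pos hR.1]; exact hR.2.le
    · filter_upwards [hev] with R hR
      filter_upwards with θ _
      rw [Real.norm_of_nonneg (by positivity)]
      apply Real.rpow_le_rpow (norm_nonneg _) _ hs.le
      apply hb
      apply cayley_re_nonneg
      rw [norm_circleMap_zero, abs_of_pos hR.1]; exact hR.2.le
    · exact intervalIntegrable_const
    · have hae : ∀ᵐ θ : ℝ, θ ≠ 2 * π := by
        simp [ae_iff, measure_singleton]
      filter_upwards [hae] with θ hθ hθ'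
      rw [Set.uIoc_of_le (by positivity)] at hθ'
      have hne : 1 - circleMap 0 1 θ ≠ 0 := by
        intro h
        have h1 : circleMap 0 1 θ = 1 := by linear_combination -h
        rw [circleMap, ofReal_one, one_mul, zero_add, Complex.exp_eq_one_iff] at h1
        obtain ⟨n, hn⟩ := h1
        have h2 : (θ : ℂ) = ((n * (2 * π) : ℝ) : ℂ) := by
          apply mul_right_cancel₀ Complex.I_ne_zero
          rw [hn]; push_cast; ring
        have h3 : θ = n * (2 * π) := by exact_mod_cast h2
        have hpi := Real.pi_pos
        have h4 : (0:ℝ) < n := by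
          by_contra hc
          push Not at hc
          nlinarith [hθ'.1]
        have h5 : (n:ℝ) ≤ 1 := by
          by_contra hc
          push Not at hc
          nlinarith [hθ'.2]
        have h6 : n = 1 := by
          have : 0 < n := by exact_mod_cast h4
          have : n ≤ 1 := by exact_mod_cast h5
          omega
        apply hθ
        rw [h3, h6]; simp
      apply Filter.Tendsto.rpow_const _ (Or.inr hs.le)
      apply Filter.Tendsto.norm
      have hmem : (1 + circleMap 0 1 θ) / (1 - circleMap 0 1 θ) ∈ {z : ℂ | 0 ≤ z.re} :=
        cayley_re_nonneg _ (by simp [norm_circleMap_zero])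
      refine (hHc _ hmem).tendsto.comp ?_
      apply tendsto_nhdsWithin_iff.mpr
      constructor
      · apply Filter.Tendsto.mono_left _ nhdsWithin_le_nhds
        have : ContinuousAt (fun R : ℝ => (1 + circleMap 0 R θ) / (1 - circleMap 0 R θ)) 1 := by
          have : Continuous (fun R : ℝ => circleMap 0 R θ) := by unfold circleMap; fun_prop
          fun_prop (disch := assumption)
        exact this
      · filter_upwards [hev] with R hR
        apply cayley_re_nonneg
        rw [norm_circleMap_zero, abs_of_pos hR.1]; exact hR.2.le
  have hle : ‖H 1‖ ^ s ≤ circleAverage (fun z => ‖F z‖ ^ s) 0 1 := by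
    apply ge_of_tendsto hlim
    have hev : ∀ᶠ R in nhdsWithin (1:ℝ) (Set.Iio 1), 0 < R ∧ R < 1 := by
      apply Filter.Eventually.and
      · exact nhdsWithin_le_nhds (lt_mem_nhds one_pos)
      · exact self_mem_nhdsWithin
    filter_upwards [hev] with R hR
    exact hsub R hR.1 hR.2
  refine (ENNReal.ofReal_le_ofReal hle).trans ?_
  rw [circleAverage, smul_eq_mul, ENNReal.ofReal_mul (by positivity),
    intervalIntegral.integral_of_le (by positivity)]
  have h1 : ENNReal.ofReal (∫ θ in Set.Ioc 0 (2 * π), ‖F (circleMap 0 1 θ)‖ ^ s) ≤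
      ∫⁻ θ in Set.Ioo 0 (2 * π), ENNReal.ofReal (‖F (circleMap 0 1 θ)‖ ^ s) := by
    rw [integral_Ioc_eq_integral_Ioo]
    refine (ENNReal.ofReal_le_ofReal (le_abs_self _)).trans ?_
    rw [← Real.norm_eq_abs, ofReal_norm]
    refine (enorm_integral_le_lintegral_enorm _).trans_eq ?_
    apply lintegral_congr
    intro θ
    rw [← ofReal_norm, Real.norm_of_nonneg (by positivity)]
  have himg : (fun t : ℝ => π - 2 * Real.arctan t) '' Set.univ = Set.Ioo 0 (2 * π) := by
    ext θ
    simp only [Set.image_univ, Set.mem_range, Set.mem_Ioo]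
    constructor
    · rintro ⟨t, rfl⟩
      have := Real.arctan_lt_pi_div_two t
      have := Real.neg_pi_div_two_lt_arctan t
      constructor <;> linarith
    · rintro ⟨ha, hb⟩
      refine ⟨Real.tan ((π - θ) / 2), ?_⟩
      rw [Real.arctan_tan (by linarith) (by linarith)]
      ring
  have hsubst := lintegral_image_eq_lintegral_abs_deriv_mul (s := Set.univ)
    (f := fun t : ℝ => π - 2 * Real.arctan t) (f' := fun t => -(2 * (1 / (1 + t ^ 2))))
    MeasurableSet.univ
    (fun t _ => (((Real.hasDerivAt_arctan t).const_mul 2).const_sub π).hasDerivWithinAt)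
    (by intro x _ y _ h; apply Real.arctan_injective; simp only at h; linarith)
    (fun θ => ENNReal.ofReal (‖F (circleMap 0 1 θ)‖ ^ s))
  rw [himg] at hsubst
  refine (mul_le_mul_right h1 _).trans ?_
  rw [hsubst, setLIntegral_univ, ← lintegral_const_mul' _ _ ENNReal.ofReal_ne_top]
  apply le_of_eq
  apply lintegral_congr
  intro t
  rw [← mul_assoc, ← ENNReal.ofReal_mul (by positivity)]
  simp only [hF, cayley_angle]
  congr 2
  rw [abs_neg, abs_of_pos (by positivity)]
  field_simp

theorem poisson_half {H : ℂ → ℂ} {M s : ℝ} (hs : 0 < s)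
    (hd : DiffContOnCl ℂ H {z | 0 < z.re}) (hb : ∀ z : ℂ, 0 ≤ z.re → ‖H z‖ ≤ M)
    (a b : ℝ) (ha : 0 < a) :
    ENNReal.ofReal (‖H (a + b * I)‖ ^ s) ≤
      ∫⁻ t : ℝ, ENNReal.ofReal (a / (π * ((t - b) ^ 2 + a ^ 2))) *
        ENNReal.ofReal (‖H (t * I)‖ ^ s) := by
  have hcl : closure {z : ℂ | 0 < z.re} = {z : ℂ | 0 ≤ z.re} := Complex.closure_setOfPred_lt_re 0
  have h := poisson_one (H := fun z => H (a * z + b * I)) (M := M) hs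
    (by
      constructor
      · apply hd.differentiableOn.comp (t := {z : ℂ | 0 < z.re}) (by fun_prop)
        intro z hz
        simp at hz ⊢
        positivity
      · rw [hcl]
        have := hd.continuousOn
        rw [hcl] at this
        apply this.comp (by fun_prop)
        intro z hz
        simp at hz ⊢
        positivity)
    (by
      intro z hz
      apply hb
      simp
      positivity)
  rw [mul_one] at h
  refine h.trans_eq ?_
  have himg : (fun t : ℝ => a * t + b) '' Set.univ = Set.univ := by
    rw [Set.image_univ, Set.range_eq_univ]
    intro y
    refine ⟨(y - b) / a, ?_⟩
    field_simp; ring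
  have hsubst := lintegral_image_eq_lintegral_abs_deriv_mul (s := Set.univ)
    (f := fun t : ℝ => a * t + b) (f' := fun t => a * 1)
    MeasurableSet.univ
    (fun t _ => (((hasDerivAt_id t).const_mul a).add_const b).hasDerivWithinAt)
    (by intro x _ y _ h; simp only at h; have : a * x = a * y := by linarith
        exact mul_left_cancel₀ ha.ne' this)
    (fun t => ENNReal.ofReal (a / (π * ((t - b) ^ 2 + a ^ 2))) *
        ENNReal.ofReal (‖H (t * I)‖ ^ s))
  rw [himg, setLIntegral_univ, setLIntegral_univ] at hsubst
  rw [hsubst]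
  apply lintegral_congr
  intro t
  rw [mul_one, abs_of_pos ha]
  conv_rhs => rw [← mul_assoc, ← ENNReal.ofReal_mul ha.le]
  congr 2
  · rw [add_sub_cancel_right]
    field_simp
    ring
  · push_cast; ring_nf


theorem lintegral_poisson (a b : ℝ) (ha : 0 < a) :
    ∫⁻ t : ℝ, ENNReal.ofReal (a / (π * ((t - b) ^ 2 + a ^ 2))) = 1 := by
  have himg : (fun t : ℝ => a * t + b) '' Set.univ = Set.univ := by
    rw [Set.image_univ, Set.range_eq_univ]
    intro y
    refine ⟨(y - b) / a, ?_⟩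
    field_simp; ring
  have hsubst := lintegral_image_eq_lintegral_abs_deriv_mul (s := Set.univ)
    (f := fun t : ℝ => a * t + b) (f' := fun t => a * 1)
    MeasurableSet.univ
    (fun t _ => (((hasDerivAt_id t).const_mul a).add_const b).hasDerivWithinAt)
    (by intro x _ y _ h; simp only at h; have : a * x = a * y := by linarith
        exact mul_left_cancel₀ ha.ne' this)
    (fun t => ENNReal.ofReal (a / (π * ((t - b) ^ 2 + a ^ 2))))
  rw [himg, setLIntegral_univ, setLIntegral_univ] at hsubst
  rw [hsubst]
  have : ∀ t : ℝ, ENNReal.ofReal |a * 1| *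
      ENNReal.ofReal (a / (π * ((a * t + b - b) ^ 2 + a ^ 2)))
      = ENNReal.ofReal (π⁻¹ * (1 + t ^ 2)⁻¹) := by
    intro t
    rw [mul_one, abs_of_pos ha, ← ENNReal.ofReal_mul ha.le]
    congr 1
    rw [add_sub_cancel_right]
    field_simp
    ring
  simp_rw [this]
  rw [← ofReal_integral_eq_lintegral_ofReal]
  · rw [integral_const_mul, integral_univ_inv_one_add_sq, inv_mul_cancel₀ Real.pi_pos.ne']
    simp
  · exact integrable_inv_one_add_sq.const_mul _
  · filter_upwards with t
    positivity

theorem ExpTypePi.comp_neg {f : ℂ → ℂ} (hf : ExpTypePi f) : ExpTypePi (fun z => f (-z)) := by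
  refine ⟨hf.1.comp differentiable_neg, fun ε hε => ?_⟩
  obtain ⟨C, hC, h⟩ := hf.2 ε hε
  refine ⟨C, hC, fun z => ?_⟩
  simpa using h (-z)

theorem ExpTypePi.comp_add {f : ℂ → ℂ} (hf : ExpTypePi f) (c : ℂ) :
    ExpTypePi (fun z => f (z + c)) := by
  refine ⟨hf.1.comp (differentiable_id.add_const c), fun ε hε => ?_⟩
  obtain ⟨C, hC, h⟩ := hf.2 ε hε
  refine ⟨C * Real.exp ((π + ε) * ‖c‖), by positivity, fun z => ?_⟩
  refine (h (z + c)).trans ?_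
  rw [mul_assoc, ← Real.exp_add]
  have : ‖z + c‖ ≤ ‖z‖ + ‖c‖ := norm_add_le _ _
  have := Real.pi_pos
  gcongr
  nlinarith

theorem ExpTypePi.comp_conj {f : ℂ → ℂ} (hf : ExpTypePi f) :
    ExpTypePi (fun z => (starRingEnd ℂ) (f ((starRingEnd ℂ) z))) := by
  refine ⟨fun z => ?_, fun ε hε => ?_⟩
  · have := DifferentiableAt.conj_conj (hf.1 ((starRingEnd ℂ) z))
    rw [Complex.conj_conj] at this
    exact this
  obtain ⟨C, hC, h⟩ := hf.2 ε hε
  refine ⟨C, hC, fun z => ?_⟩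
  simpa using h ((starRingEnd ℂ) z)

theorem pl_upper {f : ℂ → ℂ} (hf : ExpTypePi f) {M : ℝ} (hM : ∀ x : ℝ, ‖f x‖ ≤ M)
    (z : ℂ) (hz : 0 ≤ z.im) : ‖f z‖ ≤ M * Real.exp (π * z.im) := by
  have main : ∀ ε > 0, ‖f z‖ ≤ M * Real.exp ((π + ε) * z.im) := by
    intro ε hε
    obtain ⟨C, hC, h⟩ := hf.2 ε hε
    have hfd := hf.1
    have hd : Differentiable ℂ (fun w : ℂ => f (I * w) * Complex.exp (-(π + ε : ℝ) * w)) := by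
      fun_prop
    have hnorm : ∀ w : ℂ, ‖f (I * w) * Complex.exp (-(π + ε : ℝ) * w)‖
        = ‖f (I * w)‖ * Real.exp (-(π + ε) * w.re) := by
      intro w
      rw [norm_mul, Complex.norm_exp]
      congr 2
      rw [← Complex.ofReal_neg, Complex.re_ofReal_mul]
    have hpi := Real.pi_pos
    have := PhragmenLindelof.right_half_plane_of_bounded_on_real (C := M) (z := -I * z)
      (f := fun w : ℂ => f (I * w) * Complex.exp (-(π + ε : ℝ) * w)) hd.diffContOnCl
      (by
        refine ⟨1, by norm_num, π + ε, ?_⟩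
        apply Asymptotics.IsBigO.of_bound C
        rw [Filter.eventually_inf_principal]
        filter_upwards with w hw
        rw [hnorm, Real.norm_of_nonneg (Real.exp_pos _).le, Real.rpow_one]
        have h1 := h (I * w)
        rw [norm_mul, Complex.norm_I, one_mul] at h1
        have h2 : Real.exp (-(π + ε) * w.re) ≤ 1 := by
          apply Real.exp_le_one_iff.mpr
          have : 0 < w.re := hw
          nlinarith
        calc _ ≤ ‖f (I * w)‖ * 1 := by gcongr
          _ ≤ _ := by simpa using h1)
      (by
        refine ⟨C, ?_⟩
        rw [Filter.eventually_map]
        filter_upwards [Filter.eventually_ge_atTop 0] with x hx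
        rw [hnorm]
        have h1 := h (I * x)
        rw [norm_mul, Complex.norm_I, one_mul, Complex.norm_real, Real.norm_of_nonneg hx] at h1
        calc _ ≤ C * Real.exp ((π + ε) * x) * Real.exp (-(π + ε) * x) := by
              rw [Complex.ofReal_re]; gcongr
          _ = C := by rw [mul_assoc, ← Real.exp_add]; ring_nf; simp)
      (by
        intro x
        rw [hnorm]
        have h1 := hM (-x)
        rw [show I * (x * I) = ((-x : ℝ) : ℂ) by
          push_cast; linear_combination (x : ℂ) * Complex.I_sq]
        simpa using h1)
      (by simpa using hz)
    rw [hnorm, show I * (-I * z) = z by linear_combination -z * Complex.I_sq] at this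
    have hre : (-I * z).re = z.im := by simp
    rw [hre] at this
    have h3 : 0 < Real.exp ((π + ε) * z.im) := Real.exp_pos _
    calc ‖f z‖ = ‖f z‖ * Real.exp (-(π + ε) * z.im) * Real.exp ((π + ε) * z.im) := by
          rw [mul_assoc, ← Real.exp_add]; ring_nf; simp
      _ ≤ _ := by gcongr
  have hlim : Filter.Tendsto (fun ε : ℝ => M * Real.exp ((π + ε) * z.im))
      (nhdsWithin 0 (Set.Ioi 0)) (nhds (M * Real.exp (π * z.im))) := by
    apply Filter.Tendsto.mono_left _ nhdsWithin_le_nhds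
    exact Continuous.tendsto' (by fun_prop) _ _ (by simp)
  apply ge_of_tendsto hlim
  filter_upwards [self_mem_nhdsWithin] with ε hε
  exact main ε hε

theorem pl_both {f : ℂ → ℂ} (hf : ExpTypePi f) {M : ℝ} (hM : ∀ x : ℝ, ‖f x‖ ≤ M)
    (z : ℂ) : ‖f z‖ ≤ M * Real.exp (π * |z.im|) := by
  rcases le_total 0 z.im with h | h
  · rw [abs_of_nonneg h]; exact pl_upper hf hM z h
  · rw [abs_of_nonpos h]
    have := pl_upper hf.comp_neg (M := M) (by intro x; simpa using hM (-x)) (-z) (by simpa using h)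
    simpa using this

theorem cpow_re_lower (w : ℂ) (hw : 0 ≤ w.re) :
    ‖w‖ ^ (3 / 4 : ℝ) * Real.cos (3 * π / 8) ≤ (w ^ ((3 / 4 : ℝ) : ℂ)).re := by
  rw [Complex.cpow_ofReal_re]
  gcongr
  rw [← Real.cos_abs (w.arg * (3 / 4))]
  have h1 : |w.arg| ≤ π / 2 := Complex.abs_arg_le_pi_div_two_iff.mpr hw
  apply Real.cos_le_cos_of_nonneg_of_le_pi (abs_nonneg _)
  · have := Real.pi_pos; linarith
  · rw [abs_mul, abs_of_pos (by norm_num : (0:ℝ) < 3 / 4)]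
    linarith

theorem cos_aux : 0 < Real.cos (3 * π / 8) := by
  have := Real.pi_pos
  apply Real.cos_pos_of_mem_Ioo
  constructor <;> linarith

/-- eighth root of unity -/
noncomputable def e8 : ℂ := (1 + I) * ((√2)⁻¹ : ℝ)

theorem e8_sq : e8 ^ 2 = I := by
  have h : ((√2)⁻¹ : ℝ) ^ 2 = 1 / 2 := by
    rw [inv_pow, Real.sq_sqrt (by norm_num)]; norm_num
  have h' : (((√2)⁻¹ : ℝ) : ℂ) ^ 2 = 1 / 2 := by
    rw [← Complex.ofReal_pow, h]; norm_num
  unfold e8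
  rw [mul_pow, h']
  linear_combination (1 / 2) * Complex.I_sq

theorem e8_norm : ‖e8‖ = 1 := by
  have h : ‖e8‖ ^ 2 = 1 := by rw [← norm_pow, e8_sq, Complex.norm_I]
  nlinarith [norm_nonneg e8]

theorem e8_re : e8.re = (√2)⁻¹ := by rw [e8, mul_comm]; simp [-Complex.ofReal_inv]
theorem e8_im : e8.im = (√2)⁻¹ := by rw [e8, mul_comm]; simp [-Complex.ofReal_inv]

theorem e8_mul_conj : e8 * (-I * e8) = 1 := by
  linear_combination -I * e8_sq - Complex.I_sq

theorem e8_sqrt (z : ℂ) (h : 0 < z.re + z.im) : e8 * (-I * z ^ 2) ^ (2⁻¹ : ℂ) = z := by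
  have h1 : -I * z ^ 2 = (-I * e8 * z) ^ 2 := by
    linear_combination (-I ^2 * z ^ 2) * e8_sq - z ^ 2 * I * Complex.I_sq
  rw [h1, Complex.sq_cpow_two_inv]
  · linear_combination z * e8_mul_conj
  · have : (-I * e8 * z).re = (√2)⁻¹ * (z.re + z.im) := by
      simp [e8_re, e8_im]; ring
    rw [this]
    positivity

theorem contW (c : ℂ) (hc : 0 < c.re) : ContinuousOn (fun w : ℂ => w ^ c) {w | 0 ≤ w.re} := by
  intro w hw
  exact (Complex.continuousAt_cpow_const_of_re_pos (Or.inl hw) hc).continuousWithinAt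

theorem diffW (c : ℂ) : DifferentiableOn ℂ (fun w : ℂ => w ^ c) {w | 0 < w.re} := by
  intro w hw
  apply DifferentiableAt.differentiableWithinAt
  apply DifferentiableAt.cpow_const differentiableAt_id
  left; exact hw

theorem quadrant_bound {f : ℂ → ℂ} (hf : ExpTypePi f) {p : ℝ} (hp : 0 < p)
    (hi : (∫⁻ x : ℝ, ENNReal.ofReal (‖f x‖ ^ p)) < ⊤) :
    ∃ M : ℝ, ∀ x : ℝ, 0 < x → ‖f (x + I)‖ ≤ M := by
  obtain ⟨C, hC, hfC⟩ := hf.2 (4 - π) (by linarith [Real.pi_lt_four])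
  simp only [add_sub_cancel] at hfC
  set h : ℂ → ℂ := fun z => f z * Complex.exp (4 * I * z) with hh
  have hhd : Differentiable ℂ h := by
    have := hf.1
    fun_prop
  have hnh : ∀ z, ‖h z‖ = ‖f z‖ * Real.exp (-(4 * z.im)) := by
    intro z
    rw [hh, norm_mul, Complex.norm_exp]
    congr 2
    simp
  have hhC : ∀ z, ‖h z‖ ≤ C * Real.exp (8 * ‖z‖) := by
    intro z
    rw [hnh]
    have h1 : -(4 * z.im) ≤ 4 * ‖z‖ := by
      have := Complex.abs_im_le_norm z
      have := neg_abs_le z.im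
      linarith
    calc _ ≤ C * Real.exp (4 * ‖z‖) * Real.exp (4 * ‖z‖) := by
          gcongr; exact hfC z
      _ = _ := by rw [mul_assoc, ← Real.exp_add]; ring_nf
  -- boundary
  have hbd1 : ∀ t : ℝ, 0 ≤ t → ‖h (t * I)‖ ≤ C := by
    intro t ht
    rw [hnh]
    have h1 := hfC (t * I)
    rw [norm_mul, Complex.norm_I, Complex.norm_real, Real.norm_of_nonneg ht, mul_one] at h1
    calc _ ≤ C * Real.exp (4 * t) * Real.exp (-(4 * t)) := by
          gcongr; simp
      _ = C := by rw [mul_assoc, ← Real.exp_add]; simp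
  have hbd2 : ∀ t : ℝ, ‖h t‖ = ‖f t‖ := by
    intro t; rw [hnh]; simp
  set H : ℝ → ℂ → ℂ := fun ε w =>
    h (e8 * w ^ (2⁻¹ : ℂ)) * Complex.exp (-ε * w ^ ((3 / 4 : ℝ) : ℂ)) with hH
  have hnH : ∀ ε w, ‖H ε w‖ = ‖h (e8 * w ^ (2⁻¹ : ℂ))‖ *
      Real.exp (-ε * (w ^ ((3 / 4 : ℝ) : ℂ)).re) := by
    intro ε w
    rw [hH, norm_mul, Complex.norm_exp]
    congr 2
    rw [← Complex.ofReal_neg, Complex.re_ofReal_mul]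
  have hcl : closure {z : ℂ | 0 < z.re} = {z : ℂ | 0 ≤ z.re} := Complex.closure_setOfPred_lt_re 0
  have hHd : ∀ ε, DiffContOnCl ℂ (H ε) {z | 0 < z.re} := by
    intro ε
    constructor
    · apply DifferentiableOn.mul
      · exact hhd.comp_differentiableOn ((diffW _).const_mul _)
      · exact ((diffW _).const_mul _).cexp
    · rw [hcl]
      apply ContinuousOn.mul
      · exact hhd.continuous.comp_continuousOn (continuousOn_const.mul (contW _ (by norm_num)))
      · exact (continuousOn_const.mul (contW _ (by simp))).cexp
  have hHb : ∀ ε > 0, ∃ M, ∀ z : ℂ, 0 ≤ z.re → ‖H ε z‖ ≤ M := by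
    intro ε hε
    set δ := ε * Real.cos (3 * π / 8) with hδ
    have hδ0 : 0 < δ := mul_pos hε cos_aux
    refine ⟨C * Real.exp (8 * (8 / δ) ^ 2), fun w hw => ?_⟩
    rw [hnH]
    set r := ‖w‖ ^ (1 / 4 : ℝ) with hr
    have hr0 : 0 ≤ r := by positivity
    have h1 : ‖e8 * w ^ (2⁻¹ : ℂ)‖ = r ^ 2 := by
      rw [norm_mul, e8_norm, one_mul, show (2⁻¹ : ℂ) = ((2⁻¹ : ℝ) : ℂ) by norm_num,
        Complex.norm_cpow_real, hr, ← Real.rpow_natCast, ← Real.rpow_mul (norm_nonneg _)]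
      norm_num
    have h2 : ‖w‖ ^ (3 / 4 : ℝ) = r ^ 3 := by
      rw [hr, ← Real.rpow_natCast, ← Real.rpow_mul (norm_nonneg _)]
      norm_num
    have h3 := cpow_re_lower w hw
    rw [h2] at h3
    calc _ ≤ C * Real.exp (8 * r ^ 2) * Real.exp (-ε * (r ^ 3 * Real.cos (3 * π / 8))) := by
          have := hhC (e8 * w ^ (2⁻¹ : ℂ))
          rw [h1] at this
          gcongr ?_ * Real.exp ?_
          nlinarith
      _ = C * Real.exp (8 * r ^ 2 - δ * r ^ 3) := by
          rw [mul_assoc, ← Real.exp_add, hδ]; ring_nf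
      _ ≤ _ := by
          gcongr
          rcases le_total r (8 / δ) with h4 | h4
          · have h5 : r ^ 2 ≤ (8 / δ) ^ 2 := by gcongr
            have : 0 ≤ δ * r ^ 3 := by positivity
            linarith
          · rw [div_le_iff₀ hδ0] at h4
            have h5 : 0 ≤ r ^ 2 * (r * δ - 8) := mul_nonneg (by positivity) (by linarith)
            have : 0 ≤ 8 * (8 / δ) ^ 2 := by positivity
            nlinarith
  set N := ∫⁻ x : ℝ, ENNReal.ofReal (‖f x‖ ^ p) with hN
  have key : ∀ x : ℝ, 0 < x → ∀ ε > 0, ENNReal.ofReal (‖H ε (-I * (x + I) ^ 2)‖ ^ p) ≤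
      ENNReal.ofReal (C ^ p) + N := by
    intro x hx ε hε
    obtain ⟨M, hM⟩ := hHb ε hε
    have h1 := poisson_half hp (hHd ε) hM (2 * x) (1 - x ^ 2) (by positivity)
    rw [show ((2 * x : ℝ) : ℂ) + ((1 - x ^ 2 : ℝ) : ℂ) * I = -I * (x + I) ^ 2 by
      push_cast; linear_combination ((2:ℂ) * x + I) * Complex.I_sq] at h1
    refine h1.trans ?_
    rw [← lintegral_add_compl _ (measurableSet_Ici (a := (0:ℝ)))]
    have hdamp : ∀ t : ℝ, ‖H ε (t * I)‖ ≤ ‖h (e8 * (t * I) ^ (2⁻¹ : ℂ))‖ := by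
      intro t
      rw [hnH]
      have h3 := cpow_re_lower (t * I) (by simp)
      have h4 : 0 ≤ ((t * I) ^ ((3 / 4 : ℝ) : ℂ)).re := le_trans
        (mul_nonneg (by positivity) cos_aux.le) h3
      apply mul_le_of_le_one_right (norm_nonneg _)
      apply Real.exp_le_one_iff.mpr
      nlinarith
    gcongr
    · calc _ ≤ ∫⁻ t : ℝ in Set.Ici 0, ENNReal.ofReal (2 * x / (π * ((t - (1 - x ^ 2)) ^ 2 + (2 * x) ^ 2))) *
            ENNReal.ofReal (C ^ p) := by
            apply setLIntegral_mono' measurableSet_Ici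
            intro t ht
            have ht0 : 0 ≤ t := ht
            gcongr
            refine (hdamp t).trans ?_
            rcases ht0.eq_or_lt with h0 | h0
            · rw [← h0]
              have := hbd1 0 le_rfl
              simpa using this
            · have : (t * I : ℂ) = -I * (√t * I) ^ 2 := by
                have : ((√t : ℝ) : ℂ) ^ 2 = t := by
                  rw [← Complex.ofReal_pow, Real.sq_sqrt ht0]
                rw [mul_pow, this]; linear_combination t * I * Complex.I_sq
              rw [this, e8_sqrt]
              · exact hbd1 _ (Real.sqrt_nonneg _)
              · simpa using h0
        _ ≤ ∫⁻ t : ℝ, ENNReal.ofReal (2 * x / (π * ((t - (1 - x ^ 2)) ^ 2 + (2 * x) ^ 2))) *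
            ENNReal.ofReal (C ^ p) := setLIntegral_le_lintegral _ _
        _ = _ := by
            rw [lintegral_mul_const' _ _ ENNReal.ofReal_ne_top,
              lintegral_poisson _ _ (by positivity), one_mul]
    · have himg : (fun t : ℝ => -t ^ 2) '' Set.Ioi 0 = (Set.Ici 0)ᶜ := by
        ext y
        simp only [Set.mem_image, Set.mem_Ioi, Set.mem_compl_iff, Set.mem_Ici, not_le]
        constructor
        · rintro ⟨t, ht, rfl⟩
          have : 0 < t ^ 2 := by positivity
          linarith
        · intro hy
          refine ⟨√(-y), Real.sqrt_pos.mpr (by linarith), ?_⟩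
          rw [Real.sq_sqrt (by linarith)]; ring
      have hsubst := lintegral_image_eq_lintegral_abs_deriv_mul (s := Set.Ioi 0)
        (f := fun t : ℝ => -t ^ 2) (f' := fun t => -(2 * t))
        measurableSet_Ioi
        (fun t _ => by
          have h2 : HasDerivAt (fun t : ℝ => -t ^ 2) (-(2 * t)) t := by
            have := (hasDerivAt_pow 2 t).fun_neg
            simpa using this
          exact h2.hasDerivWithinAt)
        (by intro x hx y hy h; simp only [neg_inj] at h
            exact (pow_left_inj₀ (le_of_lt hx) (le_of_lt hy) (by norm_num)).mp h)
        (fun t => ENNReal.ofReal (2 * x / (π * ((t - (1 - x ^ 2)) ^ 2 + (2 * x) ^ 2))) *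
            ENNReal.ofReal (‖H ε (t * I)‖ ^ p))
      rw [himg] at hsubst
      rw [hsubst]
      refine le_trans ?_ (setLIntegral_le_lintegral (Set.Ioi 0) _)
      apply setLIntegral_mono' measurableSet_Ioi
      intro t ht
      have ht0 : 0 < t := ht
      have h3 : ‖H ε ((-t ^ 2 : ℝ) * I)‖ ≤ ‖f t‖ := by
        refine (hdamp _).trans ?_
        rw [show (((-t ^ 2 : ℝ) : ℂ) * I) = -I * (t : ℂ) ^ 2 by push_cast; ring, e8_sqrt, hbd2]
        simpa using ht0
      rw [← mul_assoc, ← ENNReal.ofReal_mul (by positivity), abs_neg, abs_of_pos (by positivity)]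
      have h4 : 2 * t * (2 * x / (π * ((-t ^ 2 - (1 - x ^ 2)) ^ 2 + (2 * x) ^ 2))) ≤ 1 := by
        rw [mul_div_assoc', div_le_one (by positivity)]
        have hpi := Real.pi_gt_three
        have h5 : (-t ^ 2 - (1 - x ^ 2)) ^ 2 + (2 * x) ^ 2 = ((t - x) ^ 2 + 1) * ((t + x) ^ 2 + 1) := by
          ring
        rw [h5]
        have h6 : 4 * t * x ≤ ((t - x) ^ 2 + 1) * ((t + x) ^ 2 + 1) := by
          nlinarith [sq_nonneg (t - x), sq_nonneg (t + x), mul_nonneg (sq_nonneg (t - x)) (sq_nonneg (t + x))]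
        nlinarith [mul_pos ht0 hx]
      calc _ ≤ ENNReal.ofReal 1 * ENNReal.ofReal (‖f t‖ ^ p) := by gcongr
        _ = _ := by simp
  refine ⟨((ENNReal.ofReal (C ^ p) + N).toReal) ^ (1 / p) * Real.exp 4, fun x hx => ?_⟩
  have hfin : ENNReal.ofReal (C ^ p) + N ≠ ⊤ := by
    simp [hi.ne]
  have key2 : ‖h (x + I)‖ ≤ ((ENNReal.ofReal (C ^ p) + N).toReal) ^ (1 / p) := by
    have hlim : Filter.Tendsto (fun ε : ℝ => ‖H ε (-I * (x + I) ^ 2)‖)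
        (nhdsWithin 0 (Set.Ioi 0)) (nhds ‖h (x + I)‖) := by
      apply Filter.Tendsto.mono_left _ nhdsWithin_le_nhds
      simp_rw [hnH]
      apply Continuous.tendsto' (by fun_prop)
      rw [e8_sqrt _ (by simp; positivity)]
      simp
    apply le_of_tendsto hlim
    filter_upwards [self_mem_nhdsWithin] with ε hε
    have h1 := key x hx ε hε
    rw [ENNReal.ofReal_le_iff_le_toReal hfin] at h1
    have h2 := Real.rpow_le_rpow (by positivity) h1 (by positivity : 0 ≤ 1 / p)
    rwa [← Real.rpow_mul (norm_nonneg _), mul_one_div_cancel hp.ne', Real.rpow_one] at h2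
  have h3 := hnh (x + I)
  have h4 : ‖f (x + I)‖ = ‖h (x + I)‖ * Real.exp 4 := by
    rw [h3, mul_assoc, ← Real.exp_add]; simp
  rw [h4]
  gcongr

theorem real_bound {f : ℂ → ℂ} (hf : ExpTypePi f) {p : ℝ} (hp : 0 < p)
    (hi : (∫⁻ x : ℝ, ENNReal.ofReal (‖f x‖ ^ p)) < ⊤) :
    ∃ M : ℝ, ∀ x : ℝ, ‖f x‖ ≤ M := by
  obtain ⟨M1, h1⟩ := quadrant_bound hf hp hi
  obtain ⟨M2, h2⟩ := quadrant_bound hf.comp_neg.comp_conj hp (by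
    simp only [Complex.conj_ofReal, Complex.norm_conj]
    have := lintegral_neg_eq_self (μ := volume) (fun x : ℝ => ENNReal.ofReal (‖f x‖ ^ p))
    simp only [Complex.ofReal_neg] at this
    rwa [this])
  set M := max (max M1 M2) ‖f I‖
  have hM : ∀ x : ℝ, ‖f (x + I)‖ ≤ M := by
    intro x
    rcases lt_trichotomy x 0 with h | h | h
    · have := h2 (-x) (by linarith)
      simp at this
      rw [add_comm] at this
      exact this.trans ((le_max_right _ _).trans (le_max_left _ _))
    · rw [h]; simp [M]
    · exact (h1 x h).trans ((le_max_left _ _).trans (le_max_left _ _))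
  refine ⟨M * Real.exp π, fun x => ?_⟩
  have := pl_both (hf.comp_add I) hM (x - I)
  simpa using this


noncomputable def PK (y x t : ℝ) : ℝ≥0∞ := ENNReal.ofReal (y / (π * ((t - x) ^ 2 + y ^ 2)))

theorem PK_meas : Measurable (fun q : ℝ × ℝ × ℝ => PK q.1 q.2.1 q.2.2) := by
  unfold PK
  fun_prop

theorem PK_meas2 (y : ℝ) : Measurable (fun q : ℝ × ℝ => PK y q.1 q.2) := by
  unfold PK
  fun_prop

theorem PK_int_t (y x : ℝ) (hy : 0 < y) : ∫⁻ t, PK y x t = 1 := lintegral_poisson y x hy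

theorem PK_int_x (y t : ℝ) (hy : 0 < y) : ∫⁻ x, PK y x t = 1 := by
  rw [← lintegral_poisson y t hy]
  congr 1; ext x; unfold PK; congr 3; ring

theorem PK_le (y x t : ℝ) (hy : 0 < y) : PK y x t ≤ ENNReal.ofReal (y⁻¹) := by
  unfold PK
  apply ENNReal.ofReal_le_ofReal
  rw [div_le_iff₀ (by positivity)]
  have := Real.pi_gt_three
  have h1 : y⁻¹ * (π * ((t - x) ^ 2 + y ^ 2)) = π * (y⁻¹ * (t-x)^2 + y) := by field_simp
  rw [h1]
  have : 0 ≤ y⁻¹ * (t-x)^2 := by positivity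
  nlinarith

/-- Jensen for the Poisson kernel. -/
theorem PK_jensen (y x : ℝ) (hy : 0 < y) (φ : ℝ → ℝ≥0∞) (hφ : Measurable φ) (q : ℝ) (hq : 1 ≤ q) :
    (∫⁻ t, PK y x t * φ t) ^ q ≤ ∫⁻ t, PK y x t * φ t ^ q := by
  have hm : Measurable (fun t => PK y x t) := by unfold PK; fun_prop
  let μ : Measure ℝ := volume.withDensity (fun t => PK y x t)
  have : IsProbabilityMeasure μ := ⟨by
    simp only [μ]
    rw [withDensity_apply _ MeasurableSet.univ, setLIntegral_univ, PK_int_t y x hy]⟩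
  have h1 : ∫⁻ t, PK y x t * φ t = ∫⁻ t, φ t ∂μ := by
    rw [lintegral_withDensity_eq_lintegral_mul _ hm hφ]; rfl
  have h2 : ∫⁻ t, PK y x t * φ t ^ q = ∫⁻ t, φ t ^ q ∂μ := by
    rw [lintegral_withDensity_eq_lintegral_mul _ hm (hφ.pow_const q)]; rfl
  rw [h1, h2]
  have h3 := eLpNorm'_le_eLpNorm'_of_exponent_le (μ := μ) (f := φ) one_pos hq hφ.aestronglyMeasurable
  simp only [eLpNorm', enorm_eq_self, ENNReal.rpow_one, div_one, one_div] at h3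
  calc _ ≤ ((∫⁻ t, φ t ^ q ∂μ) ^ q⁻¹) ^ q := ENNReal.rpow_le_rpow h3 (by linarith)
    _ = _ := by rw [← ENNReal.rpow_mul, inv_mul_cancel₀ (by linarith), ENNReal.rpow_one]

theorem PK_u1 (y : ℝ) (hy : 0 < y) (φ : ℝ → ℝ≥0∞) (hφ : Measurable φ) (q : ℝ) (hq : 1 ≤ q) :
    ∫⁻ x, (∫⁻ t, PK y x t * φ t) ^ q ≤
      (ENNReal.ofReal y⁻¹ * ∫⁻ t, φ t) ^ (q - 1) * ∫⁻ t, φ t := by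
  have h1 : ∀ x, (∫⁻ t, PK y x t * φ t) ^ q ≤
      (ENNReal.ofReal y⁻¹ * ∫⁻ t, φ t) ^ (q - 1) * ∫⁻ t, PK y x t * φ t := by
    intro x
    have : (∫⁻ t, PK y x t * φ t) ^ q = (∫⁻ t, PK y x t * φ t) ^ (q - 1) * ∫⁻ t, PK y x t * φ t := by
      conv_rhs => rw [← ENNReal.rpow_one (∫⁻ t, PK y x t * φ t), ← ENNReal.rpow_mul, one_mul,
        ← ENNReal.rpow_add_of_nonneg _ _ (by linarith) (by norm_num)]
      simp
    rw [this]
    gcongr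
    rw [← lintegral_const_mul _ hφ]
    apply lintegral_mono
    intro t
    exact mul_le_mul_left (PK_le y x t hy) _
  refine (lintegral_mono h1).trans ?_
  rw [lintegral_const_mul]
  · refine mul_le_mul' le_rfl ?_
    rw [lintegral_lintegral_swap]
    · apply lintegral_mono
      intro t
      simp only
      rw [lintegral_mul_const, PK_int_x y t hy, one_mul]
      unfold PK; fun_prop
    · apply Measurable.aemeasurable
      exact (PK_meas2 y).mul (hφ.comp measurable_snd)
  · exact Measurable.lintegral_prod_right' (f := fun q : ℝ × ℝ => PK y q.1 q.2 * φ q.2) ((PK_meas2 y).mul (hφ.comp measurable_snd))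

theorem PK_u2 (y : ℝ) (hy : 0 < y) (φ : ℝ → ℝ≥0∞) (hφ : Measurable φ) (q : ℝ) (hq : 1 ≤ q) :
    ∫⁻ x, (∫⁻ t, PK y x t * φ t) ^ q ≤ ∫⁻ t, φ t ^ q := by
  refine (lintegral_mono (fun x => PK_jensen y x hy φ hφ q hq)).trans ?_
  rw [lintegral_lintegral_swap]
  · apply lintegral_mono
    intro t
    simp only
    rw [lintegral_mul_const, PK_int_x y t hy, one_mul]
    unfold PK; fun_prop
  · apply Measurable.aemeasurable
    exact (PK_meas2 y).mul ((hφ.comp measurable_snd).pow_const q)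

theorem int_y1 (c : ℝ) (hc : 0 < c) : ∫⁻ y in Set.Ioi c, ENNReal.ofReal (y ^ (-(3/2) : ℝ)) =
    ENNReal.ofReal (2 * c ^ (-(1/2) : ℝ)) := by
  rw [← ofReal_integral_eq_lintegral_ofReal]
  · rw [integral_Ioi_rpow_of_lt (by norm_num) hc]
    congr 1; norm_num; ring
  · exact integrableOn_Ioi_rpow_of_lt (by norm_num) hc
  · filter_upwards [ae_restrict_mem measurableSet_Ioi] with y hy
    have : 0 < y := hc.trans hy
    positivity

theorem int_y2 (c a : ℝ) (hc : 0 < c) (ha : -1 < a) : ∫⁻ y in Set.Ioc 0 c, ENNReal.ofReal (y ^ a) =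
    ENNReal.ofReal (c ^ (a + 1) / (a + 1)) := by
  rw [← ofReal_integral_eq_lintegral_ofReal]
  · rw [← intervalIntegral.integral_of_le hc.le, integral_rpow (Or.inl ha), Real.zero_rpow (by linarith)]
    simp
  · have := intervalIntegral.intervalIntegrable_rpow' (a := 0) (b := c) ha
    exact (intervalIntegrable_iff_integrableOn_Ioc_of_le hc.le).mp this
  · filter_upwards [ae_restrict_mem measurableSet_Ioc] with y hy
    have : 0 < y := hy.1
    positivity

theorem carleson_half (g : ℝ → ℝ) (hg : Measurable g) (hg0 : ∀ t, 0 ≤ g t) (q : ℝ) (hq : 2 < q)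
    (hN : ∫⁻ t, ENNReal.ofReal (g t ^ 2) < ⊤) :
    ∫⁻ y in Set.Ioi (0:ℝ), ENNReal.ofReal (y ^ (q / 2 - 2)) *
      ∫⁻ x, (∫⁻ t, PK y x t * ENNReal.ofReal (g t)) ^ q < ⊤ := by
  set N := ∫⁻ t, ENNReal.ofReal (g t ^ 2) with hNdef
  set φ : ℝ → ℝ≥0∞ := fun t => ENNReal.ofReal (g t) with hφ
  have hφm : Measurable φ := by fun_prop
  set S : ℝ → Set ℝ := fun y => {t | 1 < y * g t ^ 2} with hS
  have hSm : ∀ y, MeasurableSet (S y) := fun y => measurableSet_lt (by fun_prop) (by fun_prop)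
  have hSm2 : MeasurableSet {w : ℝ × ℝ | w.2 ∈ S w.1} :=
    measurableSet_lt (f := fun w : ℝ × ℝ => (1:ℝ)) (g := fun w : ℝ × ℝ => w.1 * g w.2 ^ 2)
      (by fun_prop) (by fun_prop)
  set A : ℝ → ℝ≥0∞ := fun y => ∫⁻ t, (S y).indicator φ t with hA
  set B : ℝ → ℝ≥0∞ := fun y => ∫⁻ t, ((S y)ᶜ.indicator φ t) ^ q with hB
  have hjA : Measurable (fun w : ℝ × ℝ => (S w.1).indicator φ w.2) := by
    have := (hφm.comp measurable_snd).indicator (hSm2)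
    exact this
  have hjB : Measurable (fun w : ℝ × ℝ => ((S w.1)ᶜ.indicator φ w.2) ^ q) := by
    have := ((hφm.comp measurable_snd).indicator (hSm2.compl)).pow_const q
    exact this
  have hAm : Measurable A := Measurable.lintegral_prod_right' hjA
  have hBm : Measurable B := Measurable.lintegral_prod_right' hjB
  have hAle : ∀ y, 0 < y → A y ≤ ENNReal.ofReal (y ^ (1/2 : ℝ)) * N := by
    intro y hy
    rw [hNdef, ← lintegral_const_mul _ (by fun_prop)]
    apply lintegral_mono
    intro t
    simp only [Set.indicator]
    split_ifs with h
    · simp only [hφ]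
      rw [← ENNReal.ofReal_mul (by positivity)]
      apply ENNReal.ofReal_le_ofReal
      have h' : 1 < y * g t ^ 2 := h
      rw [← Real.sqrt_eq_rpow]
      have h2 : 1 ≤ √y * g t := by
        have h3 : (√y * g t) ^ 2 = y * g t ^ 2 := by rw [mul_pow, Real.sq_sqrt hy.le]
        have := mul_nonneg (Real.sqrt_nonneg y) (hg0 t)
        nlinarith
      nlinarith [hg0 t]
    · simp
  -- pointwise in y
  have hpt : ∀ y, 0 < y → ENNReal.ofReal (y ^ (q / 2 - 2)) * ∫⁻ x, (∫⁻ t, PK y x t * φ t) ^ q ≤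
      2 ^ (q - 1) * (N ^ (q - 1) * (ENNReal.ofReal (y ^ (-(3/2) : ℝ)) * A y) +
        ENNReal.ofReal (y ^ (q / 2 - 2)) * B y) := by
    intro y hy
    have hm1 : Measurable ((S y).indicator φ) := hφm.indicator (hSm y)
    have hm2 : Measurable ((S y)ᶜ.indicator φ) := hφm.indicator (hSm y).compl
    have hsp : ∀ x, (∫⁻ t, PK y x t * φ t) ^ q ≤
        2 ^ (q - 1) * ((∫⁻ t, PK y x t * (S y).indicator φ t) ^ q +
          (∫⁻ t, PK y x t * (S y)ᶜ.indicator φ t) ^ q) := by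
      intro x
      have : ∫⁻ t, PK y x t * φ t = (∫⁻ t, PK y x t * (S y).indicator φ t) +
          ∫⁻ t, PK y x t * (S y)ᶜ.indicator φ t := by
        rw [← lintegral_add_left]
        · congr 1; ext t
          rw [← mul_add]
          congr 1
          exact (congrFun (Set.indicator_self_add_compl (S y) φ) t).symm
        · have : Measurable (fun t => PK y x t) := by unfold PK; fun_prop
          exact this.mul hm1
      rw [this]
      exact ENNReal.rpow_add_le_mul_rpow_add_rpow _ _ (show 1 ≤ q by linarith)
    have hmu : ∀ ψ : ℝ → ℝ≥0∞, Measurable ψ → Measurable (fun x => (∫⁻ t, PK y x t * ψ t) ^ q) := by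
      intro ψ hψ
      exact (Measurable.lintegral_prod_right' (f := fun q : ℝ × ℝ => PK y q.1 q.2 * ψ q.2)
        ((PK_meas2 y).mul (hψ.comp measurable_snd))).pow_const q
    have h1 := PK_u1 y hy _ hm1 q (by linarith)
    have h2 := PK_u2 y hy _ hm2 q (by linarith)
    have h3 : ∫⁻ x, (∫⁻ t, PK y x t * φ t) ^ q ≤ 2 ^ (q - 1) *
        ((ENNReal.ofReal y⁻¹ * A y) ^ (q - 1) * A y + B y) := by
      refine (lintegral_mono hsp).trans ?_
      have hadd : Measurable (fun x => (∫⁻ t, PK y x t * (S y).indicator φ t) ^ q +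
          (∫⁻ t, PK y x t * (S y)ᶜ.indicator φ t) ^ q) := (hmu _ hm1).add (hmu _ hm2)
      rw [lintegral_const_mul _ hadd, lintegral_add_left (hmu _ hm1)]
      gcongr
    have h4 : (ENNReal.ofReal y⁻¹ * A y) ^ (q - 1) ≤
        ENNReal.ofReal (y ^ (-(q - 1) / 2)) * N ^ (q - 1) := by
      calc (ENNReal.ofReal y⁻¹ * A y) ^ (q - 1)
          ≤ (ENNReal.ofReal (y ^ (-(1/2) : ℝ)) * N) ^ (q - 1) := by
            apply ENNReal.rpow_le_rpow _ (by linarith)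
            calc _ ≤ ENNReal.ofReal y⁻¹ * (ENNReal.ofReal (y ^ (1/2 : ℝ)) * N) := by
                  gcongr; exact hAle y hy
              _ = _ := by
                  rw [← mul_assoc, ← ENNReal.ofReal_mul (by positivity)]
                  congr 2
                  rw [← Real.rpow_neg_one, ← Real.rpow_add hy]; norm_num
        _ = _ := by
            rw [ENNReal.mul_rpow_of_nonneg _ _ (by linarith),
              ENNReal.ofReal_rpow_of_nonneg (by positivity) (by linarith), ← Real.rpow_mul hy.le]
            congr 3; ring
    calc _ ≤ ENNReal.ofReal (y ^ (q / 2 - 2)) * (2 ^ (q - 1) *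
        (ENNReal.ofReal (y ^ (-(q - 1) / 2)) * N ^ (q - 1) * A y + B y)) := by
          refine mul_le_mul' le_rfl (h3.trans ?_)
          gcongr
      _ = 2 ^ (q - 1) * (N ^ (q - 1) * (ENNReal.ofReal (y ^ (q / 2 - 2)) * ENNReal.ofReal (y ^ (-(q - 1) / 2)) * A y) +
        ENNReal.ofReal (y ^ (q / 2 - 2)) * B y) := by ring
      _ = _ := by
          rw [← ENNReal.ofReal_mul (by positivity), ← Real.rpow_add hy]
          congr 6; ring
  have hq1 : (2:ℝ≥0∞) ^ (q - 1) ≠ ⊤ := ENNReal.rpow_ne_top_of_nonneg (by linarith) (by norm_num)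
  have hNq : N ^ (q - 1) ≠ ⊤ := ENNReal.rpow_ne_top_of_nonneg (by linarith) hN.ne
  have hIA : ∫⁻ y in Set.Ioi (0:ℝ), ENNReal.ofReal (y ^ (-(3/2) : ℝ)) * A y ≤ 2 * N := by
    have e1 : ∀ y : ℝ, ENNReal.ofReal (y ^ (-(3/2) : ℝ)) * A y =
        ∫⁻ t, ENNReal.ofReal (y ^ (-(3/2) : ℝ)) * (S y).indicator φ t := by
      intro y
      rw [lintegral_const_mul _ (hφm.indicator (hSm y))]
    simp_rw [e1]
    rw [lintegral_lintegral_swap (((by fun_prop : Measurable (fun w : ℝ × ℝ => ENNReal.ofReal (w.1 ^ (-(3/2) : ℝ)))).mul hjA).aemeasurable),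
      hNdef, ← lintegral_const_mul _ (by fun_prop)]
    apply lintegral_mono
    intro t
    simp only
    rcases (hg0 t).eq_or_lt with h0 | h0
    · have : ∀ y : ℝ, (S y).indicator φ t = 0 := by
        intro y
        simp [Set.indicator, hφ, ← h0]
      simp [this]
    · have e2 : ∀ y ∈ Set.Ioi (0:ℝ), ENNReal.ofReal (y ^ (-(3/2) : ℝ)) * (S y).indicator φ t =
          (Set.Ioi ((g t ^ 2)⁻¹)).indicator (fun y => ENNReal.ofReal (y ^ (-(3/2) : ℝ)) * φ t) y := by
        intro y hy
        have : t ∈ S y ↔ y ∈ Set.Ioi ((g t ^ 2)⁻¹) := by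
          simp only [hS, Set.mem_ofPred_eq, Set.mem_Ioi]
          rw [inv_lt_iff_one_lt_mul₀ (by positivity)]
        by_cases h : t ∈ S y
        · rw [Set.indicator_of_mem h, Set.indicator_of_mem (this.mp h)]
        · rw [Set.indicator_of_notMem h, Set.indicator_of_notMem (fun h' => h (this.mpr h')), mul_zero]
      rw [setLIntegral_congr_fun measurableSet_Ioi e2]
      refine (setLIntegral_le_lintegral _ _).trans ?_
      rw [lintegral_indicator measurableSet_Ioi, lintegral_mul_const _ (by fun_prop),
        int_y1 _ (by positivity)]
      simp only [hφ]
      rw [← ENNReal.ofReal_mul (by positivity), show (2:ℝ≥0∞) = ENNReal.ofReal 2 by simp,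
        ← ENNReal.ofReal_mul (by positivity)]
      apply le_of_eq
      congr 1
      rw [Real.rpow_neg (by positivity), ← Real.sqrt_eq_rpow, Real.sqrt_inv, Real.sqrt_sq h0.le]
      simp; ring
  have hIB : ∫⁻ y in Set.Ioi (0:ℝ), ENNReal.ofReal (y ^ (q / 2 - 2)) * B y ≤
      ENNReal.ofReal (1 / (q / 2 - 1)) * N := by
    have e1 : ∀ y : ℝ, ENNReal.ofReal (y ^ (q / 2 - 2)) * B y =
        ∫⁻ t, ENNReal.ofReal (y ^ (q / 2 - 2)) * ((S y)ᶜ.indicator φ t) ^ q := by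
      intro y
      rw [lintegral_const_mul _ ((hφm.indicator (hSm y).compl).pow_const q)]
    simp_rw [e1]
    rw [lintegral_lintegral_swap (((by fun_prop : Measurable (fun w : ℝ × ℝ => ENNReal.ofReal (w.1 ^ (q / 2 - 2)))).mul hjB).aemeasurable),
      hNdef, ← lintegral_const_mul _ (by fun_prop)]
    apply lintegral_mono
    intro t
    simp only
    rcases (hg0 t).eq_or_lt with h0 | h0
    · have : ∀ y : ℝ, (S y)ᶜ.indicator φ t = 0 := by
        intro y
        simp [Set.indicator, hφ, ← h0]
      simp [this, ENNReal.zero_rpow_of_pos (show 0 < q by linarith)]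
    · have e2 : ∀ y ∈ Set.Ioi (0:ℝ), ENNReal.ofReal (y ^ (q / 2 - 2)) * ((S y)ᶜ.indicator φ t) ^ q =
          (Set.Ioc 0 ((g t ^ 2)⁻¹)).indicator (fun y => ENNReal.ofReal (y ^ (q / 2 - 2)) * φ t ^ q) y := by
        intro y hy
        have : t ∈ (S y)ᶜ ↔ y ∈ Set.Ioc 0 ((g t ^ 2)⁻¹) := by
          have hy' : 0 < y := hy
          simp only [hS, Set.mem_compl_iff, Set.mem_ofPred_eq, Set.mem_Ioc, not_lt, hy', true_and]
          rw [← one_div, le_div_iff₀ (by positivity)]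
        by_cases h : t ∈ (S y)ᶜ
        · rw [Set.indicator_of_mem h, Set.indicator_of_mem (this.mp h)]
        · rw [Set.indicator_of_notMem h, Set.indicator_of_notMem (fun h' => h (this.mpr h')),
            ENNReal.zero_rpow_of_pos (by linarith), mul_zero]
      rw [setLIntegral_congr_fun measurableSet_Ioi e2]
      refine (setLIntegral_le_lintegral _ _).trans ?_
      rw [lintegral_indicator measurableSet_Ioc, lintegral_mul_const _ (by fun_prop),
        int_y2 _ _ (by positivity) (by linarith)]
      simp only [hφ]
      have h1 : 0 < q / 2 - 1 := by linarith
      have h2 : q / 2 - 2 + 1 = q / 2 - 1 := by ring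
      rw [h2, ENNReal.ofReal_rpow_of_nonneg h0.le (by linarith), ← ENNReal.ofReal_mul (by positivity),
        ← ENNReal.ofReal_mul (by positivity)]
      apply le_of_eq
      congr 1
      rw [← Real.rpow_natCast, ← Real.rpow_neg h0.le, ← Real.rpow_mul h0.le, div_mul_eq_mul_div,
        ← Real.rpow_add h0, one_div, div_eq_inv_mul]
      congr 2; push_cast; ring
  calc _ ≤ ∫⁻ y in Set.Ioi (0:ℝ), 2 ^ (q - 1) * (N ^ (q - 1) * (ENNReal.ofReal (y ^ (-(3/2) : ℝ)) * A y) +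
        ENNReal.ofReal (y ^ (q / 2 - 2)) * B y) := setLIntegral_mono' measurableSet_Ioi hpt
    _ ≤ 2 ^ (q - 1) * (N ^ (q - 1) * (2 * N) + ENNReal.ofReal (1 / (q / 2 - 1)) * N) := by
        rw [lintegral_const_mul _ (by fun_prop), lintegral_add_left (by fun_prop),
          lintegral_const_mul _ (by fun_prop)]
        gcongr
    _ < ⊤ := by
        have := hN.ne
        apply ENNReal.mul_lt_top hq1.lt_top
        apply ENNReal.add_lt_top.mpr
        exact ⟨ENNReal.mul_lt_top hNq.lt_top (ENNReal.mul_lt_top (by norm_num) hN),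
          ENNReal.mul_lt_top (by simp) hN⟩


theorem lintegral_complex (F : ℂ → ℝ≥0∞) (hF : Measurable F) :
    ∫⁻ z : ℂ, F z = ∫⁻ y : ℝ, ∫⁻ x : ℝ, F (x + y * I) := by
  rw [← Complex.volume_preserving_equiv_real_prod.symm.lintegral_comp hF, Measure.volume_eq_prod,
    lintegral_prod_symm]
  · congr 1; ext y; congr 1; ext x; congr 1
    apply Complex.ext <;> simp [Complex.measurableEquivRealProd]
  · exact (hF.comp Complex.measurableEquivRealProd.symm.measurable).aemeasurable

theorem nnnorm_rpow_eq {w : ℂ} {p : ℝ} (hp : 0 ≤ p) :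
    (‖w‖₊ : ℝ≥0∞) ^ p = ENNReal.ofReal (‖w‖ ^ p) := by
  rw [← ENNReal.ofReal_rpow_of_nonneg (norm_nonneg _) hp, ofReal_norm]
  rfl

theorem half_finite {p : ℝ} (hp0 : 0 < p) (hp1 : p < 1) {f : ℂ → ℂ} (hf : ExpTypePi f)
    (hi : ∫⁻ x : ℝ, ENNReal.ofReal (‖f x‖ ^ p) < ⊤) :
    ∫⁻ y in Set.Ioi (0:ℝ), ∫⁻ x : ℝ, ENNReal.ofReal
      (Real.exp (-Real.pi * |y|) * |y| ^ (1 / p - 2)) * (‖f (x + y * I)‖₊ : ℝ≥0∞) < ⊤ := by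
  obtain ⟨M, hM⟩ := real_bound hf hp0 hi
  have hcont : Continuous f := hf.1.continuous
  have hb : ∀ z : ℂ, 0 ≤ z.re → ‖f (I * z) * cexp (-π * z)‖ ≤ M := by
    intro z hz
    have := pl_both hf hM (I * z)
    rw [norm_mul, Complex.norm_exp]
    simp only [Complex.mul_im, I_re, I_im, zero_mul, one_mul, zero_add, abs_of_nonneg hz] at this
    have h2 : (-(π:ℂ) * z).re = -(π * z.re) := by simp
    rw [h2]
    calc _ ≤ M * Real.exp (π * z.re) * Real.exp (-(π * z.re)) := by gcongr
      _ = M := by rw [mul_assoc, ← Real.exp_add]; simp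
  have hd : DiffContOnCl ℂ (fun z : ℂ => f (I * z) * cexp (-π * z)) {z | 0 < z.re} := by
    apply Differentiable.diffContOnCl
    have := hf.1
    fun_prop
  set g : ℝ → ℝ := fun t => ‖f t‖ ^ (p / 2) with hg
  have hgm : Measurable g := by
    have : Continuous (fun t : ℝ => ‖f t‖) := by fun_prop
    exact this.measurable.pow_const _
  have key := carleson_half g hgm (fun t => by positivity) (2 / p)
    (by rw [lt_div_iff₀ hp0]; linarith) (by
      refine lt_of_eq_of_lt ?_ hi
      congr 1; ext t; simp only [hg]
      rw [← Real.rpow_natCast, ← Real.rpow_mul (norm_nonneg _)]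
      congr 2; push_cast; ring)
  refine lt_of_le_of_lt ?_ key
  apply setLIntegral_mono' measurableSet_Ioi
  intro y hy
  have hy : 0 < y := hy
  rw [abs_of_pos hy, ← lintegral_const_mul']
  swap; · simp
  apply lintegral_mono
  intro x
  simp only
  have h1 := poisson_half (s := p / 2) (by positivity) hd hb y (-x) hy
  have h2 : ∫⁻ t : ℝ, ENNReal.ofReal (y / (π * ((t - -x) ^ 2 + y ^ 2))) *
      ENNReal.ofReal (‖f (I * (t * I)) * cexp (-π * (t * I))‖ ^ (p / 2)) =
      ∫⁻ t, PK y x t * ENNReal.ofReal (g t) := by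
    rw [← lintegral_neg_eq_self]
    congr 1; ext t
    unfold PK
    congr 2
    · congr 3; ring
    · simp only [hg]
      rw [norm_mul, Complex.norm_exp]
      have e1 : I * (((-t : ℝ) : ℂ) * I) = t := by
        push_cast
        linear_combination (-t : ℂ) * Complex.I_mul_I
      have e2 : (-(π:ℂ) * (((-t : ℝ) : ℂ) * I)).re = 0 := by simp
      rw [e1, e2]; simp
  rw [h2] at h1
  set u := ∫⁻ t, PK y x t * ENNReal.ofReal (g t)
  have e3 : I * ((y : ℂ) + ((-x : ℝ) : ℂ) * I) = x + y * I := by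
    push_cast
    linear_combination (-x : ℂ) * Complex.I_mul_I
  have e4 : (-(π:ℂ) * ((y : ℂ) + ((-x : ℝ) : ℂ) * I)).re = -π * y := by simp
  rw [norm_mul, Complex.norm_exp, e3, e4] at h1
  have h3 : ENNReal.ofReal (‖f (x + y * I)‖ * Real.exp (-π * y)) ≤ u ^ (2 / p) := by
    have := ENNReal.rpow_le_rpow h1 (show 0 ≤ 2 / p by positivity)
    rw [ENNReal.ofReal_rpow_of_nonneg (by positivity) (by positivity), ← Real.rpow_mul (by positivity),
      show p / 2 * (2 / p) = 1 by field_simp, Real.rpow_one] at this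
    exact this
  calc _ = ENNReal.ofReal (y ^ (1 / p - 2)) * ENNReal.ofReal (‖f (x + y * I)‖ * Real.exp (-π * y)) := by
        rw [← ENNReal.ofReal_mul (by positivity)]
        rw [show (‖f (x + y * I)‖₊ : ℝ≥0∞) = ENNReal.ofReal ‖f (x + y * I)‖ by
          rw [ofReal_norm]; rfl, ← ENNReal.ofReal_mul (by positivity)]
        congr 1; ring
    _ ≤ _ := by
        rw [show 2 / p / 2 - 2 = 1 / p - 2 by field_simp]
        gcongr

theorem W_meas {p : ℝ} {f : ℂ → ℂ} (hf : Continuous f) : Measurable (fun z : ℂ => ENNReal.ofReal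
      (Real.exp (-Real.pi * |z.im|) * |z.im| ^ (1 / p - 2)) * (‖f z‖₊ : ℝ≥0∞)) := by
  have : Measurable f := hf.measurable
  fun_prop

theorem part1 {p : ℝ} (hp0 : 0 < p) (hp1 : p < 1) {f : ℂ → ℂ} (hf : ExpTypePi f)
    (hi : (∫⁻ x : ℝ, (‖f x‖₊ : ℝ≥0∞) ^ p) < ⊤) : ZNorm p f < ⊤ := by
  simp_rw [nnnorm_rpow_eq hp0.le] at hi
  unfold ZNorm
  rw [lintegral_complex _ (W_meas hf.1.continuous), ← lintegral_add_compl _ (measurableSet_Ioi (a := (0:ℝ)))]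
  have h1 := half_finite hp0 hp1 hf hi
  have h2 := half_finite hp0 hp1 hf.comp_neg (by
    rw [← lintegral_neg_eq_self] at hi
    simpa using hi)
  apply ENNReal.add_lt_top.mpr
  constructor
  · simpa using h1
  · rw [Set.compl_Ioi, setLIntegral_congr Iio_ae_eq_Iic.symm]
    rw [← lintegral_indicator measurableSet_Ioi] at h2
    rw [← lintegral_indicator measurableSet_Iio, ← lintegral_neg_eq_self]
    refine lt_of_eq_of_lt (lintegral_congr fun y => ?_) h2
    simp only [Set.indicator, Set.mem_Iio, Set.mem_Ioi, neg_lt_zero]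
    split_ifs
    · rw [← lintegral_neg_eq_self]
      simp [add_comm]
    · rfl


theorem circle_lint {F : ℂ → ℂ} (hF : Differentiable ℂ F) {ρ : ℝ} (hρ : 0 < ρ) :
    ENNReal.ofReal ‖F 0‖ ≤ ENNReal.ofReal (2 * π)⁻¹ *
      ∫⁻ θ in Set.Ioo (-π) π, ENNReal.ofReal ‖F (ρ * (Real.cos θ + Real.sin θ * I))‖ := by
  have h1 := submean_circle (F := F) (s := 1) hρ one_pos (fun z _ => hF.analyticAt z)
  simp only [Real.rpow_one] at h1
  rw [circleAverage_eq_integral_add (-π), intervalIntegral.integral_comp_add_right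
    (fun θ => ‖F (circleMap 0 ρ θ)‖), smul_eq_mul] at h1
  have e1 : (0:ℝ) + -π = -π := by ring
  have e2 : 2 * π + -π = π := by ring
  have hc : Continuous (fun θ => ‖F (circleMap 0 ρ θ)‖) := by
    have := hF.continuous
    fun_prop
  rw [e1, e2, intervalIntegral.integral_of_le (by linarith [Real.pi_pos]),
    integral_Ioc_eq_integral_Ioo] at h1
  refine (ENNReal.ofReal_le_ofReal h1).trans ?_
  rw [ENNReal.ofReal_mul (by positivity), ofReal_integral_eq_lintegral_ofReal]
  · apply le_of_eq
    congr 2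
    ext θ
    congr 3
    rw [circleMap, Complex.exp_mul_I]
    push_cast
    ring
  · exact (hc.integrableOn_Icc (a := -π) (b := π)).mono_set Set.Ioo_subset_Icc_self
  · filter_upwards with θ
    positivity

theorem growth_aux {p : ℝ} (hp0 : 0 < p) {f : ℂ → ℂ} (hf : Differentiable ℂ f)
    {k : ℕ} (hk1 : 1 ≤ k) (hk : 1 / p - 2 ≤ k) (z : ℂ) {ρ : ℝ} (hρ : 0 < ρ) (hρ1 : ρ < 1) :
    ENNReal.ofReal (‖f z‖ * ρ ^ k) ≤ ENNReal.ofReal (2 ^ k * (Real.exp (π * (|z.im| + 1)) * (|z.im| + 1) ^ (k + 2))) *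
      ∫⁻ θ in Set.Ioo (-π) π, (fun z : ℂ => ENNReal.ofReal
      (Real.exp (-Real.pi * |z.im|) * |z.im| ^ (1 / p - 2)) * (‖f z‖₊ : ℝ≥0∞))
        (z + ρ * (Real.cos θ + Real.sin θ * I)) := by
  set F : ℂ → ℂ := fun w => f (z + w) * ((w + z.im * I) ^ 2 - ρ ^ 2 + z.im ^ 2) ^ k with hFdef
  have hF : Differentiable ℂ F := by fun_prop
  have h1 := circle_lint hF hρ
  have e0 : ‖F 0‖ = ρ ^ k * (‖f z‖ * ρ ^ k) := by
    simp only [hFdef, add_zero, zero_add, norm_mul, norm_pow]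
    rw [show ((z.im : ℂ) * I) ^ 2 - ρ ^ 2 + z.im ^ 2 = -(ρ:ℂ) ^ 2 by
      rw [mul_pow, I_sq]; ring]
    rw [norm_neg, norm_pow, Complex.norm_of_nonneg hρ.le]; ring
  have eθ : ∀ θ : ℝ, ‖F (ρ * (Real.cos θ + Real.sin θ * I))‖ =
      ρ ^ k * (2 ^ k * (‖f (z + ρ * (Real.cos θ + Real.sin θ * I))‖ * |z.im + ρ * Real.sin θ| ^ k)) := by
    intro θ
    simp only [hFdef, norm_mul, norm_pow]
    have hcs : (Real.cos θ : ℂ) ^ 2 + (Real.sin θ : ℂ) ^ 2 = 1 := by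
      exact_mod_cast Real.cos_sq_add_sin_sq θ
    rw [show ((ρ : ℂ) * (Real.cos θ + Real.sin θ * I) + z.im * I) ^ 2 - ρ ^ 2 + z.im ^ 2 =
      ρ * (2 * ((Real.cos θ + Real.sin θ * I) * (I * ((z.im + ρ * Real.sin θ : ℝ) : ℂ)))) by
      push_cast at *
      linear_combination ((ρ:ℂ) ^ 2) * hcs + ((z.im:ℂ)^2 - (ρ:ℂ)^2 * (Complex.sin θ)^2) * I_sq]
    have hn : ‖(Real.cos θ : ℂ) + Real.sin θ * I‖ = 1 := by
      have := Complex.norm_exp_ofReal_mul_I θ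
      rwa [Complex.exp_mul_I, ← Complex.ofReal_cos, ← Complex.ofReal_sin] at this
    rw [norm_mul, norm_mul, norm_mul, norm_mul, hn, Complex.norm_of_nonneg hρ.le, Complex.norm_I,
      Complex.norm_real, Real.norm_eq_abs]
    simp only [Complex.norm_ofNat, one_mul]
    rw [mul_pow, mul_pow]; ring
  have hY : (1:ℝ) ≤ |z.im| + 1 := by linarith [abs_nonneg z.im]
  set Y := |z.im| + 1 with hYdef
  have hpt : ∀ θ : ℝ, ENNReal.ofReal (‖f (z + ρ * (Real.cos θ + Real.sin θ * I))‖ * |z.im + ρ * Real.sin θ| ^ k)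
      ≤ ENNReal.ofReal (Real.exp (π * Y) * Y ^ (k + 2)) * (fun z : ℂ => ENNReal.ofReal
      (Real.exp (-Real.pi * |z.im|) * |z.im| ^ (1 / p - 2)) * (‖f z‖₊ : ℝ≥0∞))
        (z + ρ * (Real.cos θ + Real.sin θ * I)) := by
    intro θ
    simp only
    set v := z + ρ * (Real.cos θ + Real.sin θ * I) with hv
    have him : v.im = z.im + ρ * Real.sin θ := by
      rw [hv]; simp [-Complex.ofReal_cos, -Complex.ofReal_sin]
    rw [← him]
    have hvY : |v.im| ≤ Y := by
      rw [him]
      refine (abs_add_le _ _).trans ?_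
      rw [abs_mul, abs_of_pos hρ]
      have := Real.abs_sin_le_one θ
      have := abs_nonneg (Real.sin θ)
      nlinarith
    rw [show (‖f v‖₊ : ℝ≥0∞) = ENNReal.ofReal ‖f v‖ by
          rw [ofReal_norm]; rfl, ← ENNReal.ofReal_mul (by positivity), ← ENNReal.ofReal_mul (by positivity)]
    apply ENNReal.ofReal_le_ofReal
    have h3 : |v.im| ^ k ≤ Y ^ (k + 2) * |v.im| ^ (1 / p - 2) := by
      rcases (abs_nonneg v.im).eq_or_lt with h0 | h0
      · rw [← h0, zero_pow (by omega)]; positivity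
      · calc |v.im| ^ k = |v.im| ^ ((k:ℝ) - (1 / p - 2)) * |v.im| ^ (1 / p - 2) := by
              rw [← Real.rpow_add h0, ← Real.rpow_natCast]; congr 1; ring
          _ ≤ Y ^ ((k:ℝ) - (1 / p - 2)) * |v.im| ^ (1 / p - 2) := by
              gcongr
          _ ≤ Y ^ (k + 2) * |v.im| ^ (1 / p - 2) := by
              gcongr
              rw [← Real.rpow_natCast]
              apply Real.rpow_le_rpow_of_exponent_le hY
              push_cast
              have : 0 < 1 / p := by positivity
              linarith
    have h4 : 1 ≤ Real.exp (π * Y) * Real.exp (-π * |v.im|) := by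
      rw [← Real.exp_add]
      apply Real.one_le_exp
      nlinarith [Real.pi_pos]
    calc ‖f v‖ * |v.im| ^ k ≤ ‖f v‖ * (Y ^ (k + 2) * |v.im| ^ (1 / p - 2)) * 1 := by
          rw [mul_one]; gcongr
      _ ≤ ‖f v‖ * (Y ^ (k + 2) * |v.im| ^ (1 / p - 2)) * (Real.exp (π * Y) * Real.exp (-π * |v.im|)) := by
          gcongr
      _ = _ := by ring
  rw [e0, ENNReal.ofReal_mul (by positivity)] at h1
  have hρk : ENNReal.ofReal (ρ ^ k) ≠ 0 := by simp; positivity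
  have h5 : ENNReal.ofReal (ρ ^ k) * ENNReal.ofReal (‖f z‖ * ρ ^ k) ≤
      ENNReal.ofReal (ρ ^ k) * (ENNReal.ofReal (2 ^ k * (Real.exp (π * Y) * Y ^ (k + 2))) *
      ∫⁻ θ in Set.Ioo (-π) π, (fun z : ℂ => ENNReal.ofReal
      (Real.exp (-Real.pi * |z.im|) * |z.im| ^ (1 / p - 2)) * (‖f z‖₊ : ℝ≥0∞))
        (z + ρ * (Real.cos θ + Real.sin θ * I))) := by
    refine h1.trans ?_
    rw [← lintegral_const_mul' _ _ ENNReal.ofReal_ne_top, ← lintegral_const_mul' _ _ ENNReal.ofReal_ne_top,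
      ← lintegral_const_mul' _ _ ENNReal.ofReal_ne_top]
    apply lintegral_mono
    intro θ
    simp only
    rw [eθ, ENNReal.ofReal_mul (by positivity), ENNReal.ofReal_mul (by positivity)]
    have h6 : ENNReal.ofReal (2 * π)⁻¹ ≤ 1 := by
      rw [← ENNReal.ofReal_one]
      apply ENNReal.ofReal_le_ofReal
      apply inv_le_one_of_one_le₀
      linarith [Real.pi_gt_three]
    refine (mul_le_mul' h6 le_rfl).trans ?_
    rw [one_mul, ENNReal.ofReal_mul (p := 2 ^ k) (by positivity), mul_assoc (ENNReal.ofReal (2 ^ k))]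
    refine mul_le_mul' le_rfl (mul_le_mul' le_rfl ?_)
    exact hpt θ
  exact (ENNReal.mul_le_mul_iff_right hρk (by simp)).mp h5

theorem growth {p : ℝ} (hp0 : 0 < p) {f : ℂ → ℂ} (hf : Differentiable ℂ f) (hZ : ZNorm p f < ⊤) :
    ∃ C : ℝ, 0 < C ∧ ∃ m : ℕ, ∀ z : ℂ, ‖f z‖ ≤ C * ((|z.im| + 1) ^ m * Real.exp (π * |z.im|)) := by
  obtain ⟨k₀, hk₀⟩ := exists_nat_ge (1 / p - 2)
  set k := k₀ + 1 with hkd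
  have hk1 : 1 ≤ k := by omega
  have hk : 1 / p - 2 ≤ k := by rw [hkd]; push_cast; linarith
  set G : ℂ → ℝ≥0∞ := (fun z : ℂ => ENNReal.ofReal
      (Real.exp (-Real.pi * |z.im|) * |z.im| ^ (1 / p - 2)) * (‖f z‖₊ : ℝ≥0∞)) with hG
  have hGm : Measurable G := W_meas hf.continuous
  refine ⟨2 ^ (k + 2) * 2 ^ k * Real.exp π * ((ZNorm p f).toReal + 1), by positivity, k + 2, fun z => ?_⟩
  set E : ℝ := 2 ^ k * (Real.exp (π * (|z.im| + 1)) * (|z.im| + 1) ^ (k + 2)) with hE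
  have hE0 : 0 ≤ E := by positivity
  have key : ENNReal.ofReal (‖f z‖ * (1/2) ^ (k + 1)) * ENNReal.ofReal (1/2) ≤
      ENNReal.ofReal E * ZNorm p f := by
    calc ENNReal.ofReal (‖f z‖ * (1/2) ^ (k + 1)) * ENNReal.ofReal (1/2)
        = ∫⁻ ρ in Set.Ioo (1/2:ℝ) 1, ENNReal.ofReal (‖f z‖ * (1/2) ^ (k + 1)) := by
          rw [setLIntegral_const, Real.volume_Ioo]; norm_num
      _ ≤ ∫⁻ ρ in Set.Ioo (1/2:ℝ) 1, ENNReal.ofReal ρ * (ENNReal.ofReal E *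
            ∫⁻ θ in Set.Ioo (-π) π, G (z + ρ * (Real.cos θ + Real.sin θ * I))) := by
          apply setLIntegral_mono' measurableSet_Ioo
          intro ρ hρ
          have hρ0 : 0 < ρ := by linarith [hρ.1]
          refine le_trans ?_ (mul_le_mul' le_rfl (growth_aux hp0 hf hk1 hk z hρ0 hρ.2))
          rw [← ENNReal.ofReal_mul hρ0.le]
          apply ENNReal.ofReal_le_ofReal
          have : (1/2:ℝ) ^ (k+1) ≤ ρ ^ (k + 1) := by gcongr; exact hρ.1.le
          calc _ ≤ ‖f z‖ * ρ ^ (k + 1) := by gcongr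
            _ = _ := by ring
      _ ≤ ∫⁻ ρ in Set.Ioi (0:ℝ), ENNReal.ofReal ρ * (ENNReal.ofReal E *
            ∫⁻ θ in Set.Ioo (-π) π, G (z + ρ * (Real.cos θ + Real.sin θ * I))) := by
          apply lintegral_mono_set
          intro ρ hρ
          exact lt_trans (by norm_num) hρ.1
      _ = ENNReal.ofReal E * ∫⁻ ρ in Set.Ioi (0:ℝ), ∫⁻ θ in Set.Ioo (-π) π,
            ENNReal.ofReal ρ * G (z + ρ * (Real.cos θ + Real.sin θ * I)) := by
          rw [← lintegral_const_mul' _ _ ENNReal.ofReal_ne_top]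
          congr 1; ext ρ
          rw [lintegral_const_mul' _ _ ENNReal.ofReal_ne_top]
          ring
      _ = ENNReal.ofReal E * ∫⁻ w : ℂ, G (z + w) := by
          congr 1
          rw [← Complex.lintegral_comp_polarCoord_symm, polarCoord_target, Measure.volume_eq_prod,
            ← Measure.prod_restrict, lintegral_prod]
          · simp only [Complex.polarCoord_symm_apply, smul_eq_mul]
          · apply Measurable.aemeasurable
            simp only [Complex.polarCoord_symm_apply, smul_eq_mul]
            have : Measurable (fun q : ℝ × ℝ => z + (q.1 : ℂ) * (Real.cos q.2 + Real.sin q.2 * I)) := by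
              apply Continuous.measurable
              fun_prop
            exact (by fun_prop : Measurable (fun q : ℝ × ℝ => ENNReal.ofReal q.1)).mul (hGm.comp this)
      _ = _ := by
          rw [lintegral_add_left_eq_self]; rfl
  have h2 := ENNReal.toReal_mono (ENNReal.mul_ne_top (by simp) hZ.ne) key
  rw [ENNReal.toReal_mul, ENNReal.toReal_mul, ENNReal.toReal_ofReal (by positivity),
    ENNReal.toReal_ofReal (by positivity), ENNReal.toReal_ofReal hE0] at h2
  have h3 : ‖f z‖ ≤ 2 ^ (k + 2) * (E * (ZNorm p f).toReal) := by
    calc ‖f z‖ = 2 ^ (k + 2) * (‖f z‖ * (1 / 2) ^ (k + 1) * (1 / 2)) := by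
          rw [one_div, inv_pow]; field_simp; ring
      _ ≤ _ := by gcongr
  refine h3.trans ?_
  calc _ ≤ 2 ^ (k + 2) * (E * ((ZNorm p f).toReal + 1)) := by gcongr; linarith
    _ = _ := by
      rw [hE, mul_add π, Real.exp_add, mul_one]; ring


noncomputable def csinc : ℂ → ℂ := dslope Complex.sin 0

theorem csinc_diff : Differentiable ℂ csinc := by
  have h := (Complex.differentiableOn_dslope (s := Set.univ) (c := (0:ℂ)) (f := Complex.sin)
    Filter.univ_mem).mpr Complex.differentiable_sin.differentiableOn
  exact differentiableOn_univ.mp h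

theorem csinc_zero : csinc 0 = 1 := by
  simp [csinc]

theorem csinc_mul (w : ℂ) : w * csinc w = Complex.sin w := by
  have := sub_smul_dslope Complex.sin 0 w
  simpa [csinc] using this

theorem norm_ccos_le (w : ℂ) : ‖Complex.cos w‖ ≤ Real.exp |w.im| := by
  rw [Complex.cos, norm_div, Complex.norm_ofNat, div_le_iff₀ (by norm_num)]
  refine (norm_add_le _ _).trans ?_
  rw [Complex.norm_exp, Complex.norm_exp]
  have h1 : Real.exp (w * I).re ≤ Real.exp |w.im| := by
    apply Real.exp_le_exp.mpr; simpa using neg_le_abs w.im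
  have h2 : Real.exp (-w * I).re ≤ Real.exp |w.im| := by
    apply Real.exp_le_exp.mpr; simpa using le_abs_self w.im
  linarith

theorem norm_csinc_le (w : ℂ) : ‖csinc w‖ ≤ Real.exp |w.im| := by
  by_cases hw : w = 0
  · rw [hw, csinc_zero]; simp
  have hconv : Convex ℝ {v : ℂ | |v.im| ≤ |w.im|} := by
    have : {v : ℂ | |v.im| ≤ |w.im|} = Complex.imLm ⁻¹' (Set.Icc (-|w.im|) |w.im|) := by
      ext v; simp [abs_le]
    rw [this]
    exact (convex_Icc _ _).linear_preimage Complex.imLm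
  have h := hconv.norm_image_sub_le_of_norm_deriv_le (𝕜 := ℂ) (f := Complex.sin) (C := Real.exp |w.im|)
    (x := 0) (y := w) (fun v _ => Complex.differentiableAt_sin) (fun v hv => by
      rw [Complex.deriv_sin]
      exact (norm_ccos_le v).trans (Real.exp_le_exp.mpr hv)) (by simp) (by simp)
  rw [Complex.sin_zero, sub_zero, sub_zero, ← csinc_mul, norm_mul, mul_comm] at h
  exact le_of_mul_le_mul_right h (norm_pos_iff.mpr hw)

theorem norm_csinc_real (x : ℝ) : ‖csinc x‖ ^ 2 ≤ 2 * (1 + x ^ 2)⁻¹ := by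
  have h1 : ‖csinc x‖ ≤ 1 := by simpa using norm_csinc_le x
  have h2 : |x| * ‖csinc x‖ ≤ 1 := by
    have := congrArg norm (csinc_mul x)
    rw [norm_mul, Complex.norm_real, Real.norm_eq_abs] at this
    rw [this, ← Complex.ofReal_sin, Complex.norm_real]
    exact Real.abs_sin_le_one x
  rw [← div_eq_mul_inv, le_div_iff₀ (by positivity)]
  have h3 : (|x| * ‖csinc x‖) ^ 2 ≤ 1 := pow_le_one₀ (by positivity) h2
  rw [mul_pow, sq_abs] at h3
  have h4 : ‖csinc x‖ ^ 2 ≤ 1 := pow_le_one₀ (by positivity) h1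
  linarith

noncomputable def gapp (f : ℂ → ℂ) (n : ℕ) (r : ℝ) (z : ℂ) : ℂ :=
  f (r * z) * csinc ((π * (1 - r) / n : ℝ) * z) ^ n

theorem gapp_bound (f : ℂ → ℂ) {n : ℕ} (hn : 0 < n) {r : ℝ} (hr : r < 1) (z : ℂ) :
    ‖gapp f n r z‖ ≤ ‖f (r * z)‖ * Real.exp (π * (1 - r) * |z.im|) := by
  unfold gapp
  rw [norm_mul, norm_pow]
  gcongr
  have hn' : (0:ℝ) < n := by exact_mod_cast hn
  have h0 : 0 ≤ π * (1 - r) / n := by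
    have : 0 < 1 - r := by linarith
    positivity
  refine (pow_le_pow_left₀ (norm_nonneg _) (norm_csinc_le _) n).trans ?_
  rw [← Real.exp_nat_mul]
  apply Real.exp_le_exp.mpr
  rw [Complex.im_ofReal_mul, abs_mul, abs_of_nonneg h0]
  apply le_of_eq
  field_simp

theorem gapp_diff {f : ℂ → ℂ} (hf : Differentiable ℂ f) (n : ℕ) (r : ℝ) :
    Differentiable ℂ (gapp f n r) := by
  unfold gapp
  have := csinc_diff
  fun_prop

theorem poly_exp (m : ℕ) {ε : ℝ} (hε : 0 < ε) : ∃ C : ℝ, 0 < C ∧ ∀ t : ℝ, 0 ≤ t →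
    (t + 1) ^ m ≤ C * Real.exp (ε * t) := by
  refine ⟨(m.factorial / ε ^ m) * Real.exp ε , by positivity, fun t ht => ?_⟩
  have h := Real.pow_div_factorial_le_exp (ε * (t + 1)) (by positivity) m
  rw [div_le_iff₀ (by positivity), mul_pow] at h
  rw [mul_assoc, ← Real.exp_add, show ε + ε * t = ε * (t + 1) by ring, div_mul_eq_mul_div,
    le_div_iff₀ (by positivity)]
  linarith

theorem gapp_exp {p : ℝ} (hp0 : 0 < p) {f : ℂ → ℂ} (hf : Differentiable ℂ f) (hZ : ZNorm p f < ⊤)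
    {n : ℕ} (hn : 0 < n) {r : ℝ} (hr0 : 0 < r) (hr : r < 1) : ExpTypePi (gapp f n r) := by
  refine ⟨gapp_diff hf n r, fun ε hε => ?_⟩
  obtain ⟨C, hC, m, h⟩ := growth hp0 hf hZ
  obtain ⟨D, hD, h2⟩ := poly_exp m hε
  refine ⟨C * D, by positivity, fun z => ?_⟩
  refine (gapp_bound f hn hr z).trans ?_
  have h3 := h (r * z)
  rw [Complex.im_ofReal_mul, abs_mul, abs_of_pos hr0] at h3
  have h4 : (r * |z.im| + 1) ^ m ≤ (|z.im| + 1) ^ m := by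
    gcongr
    nlinarith [abs_nonneg z.im]
  calc _ ≤ C * ((r * |z.im| + 1) ^ m * Real.exp (π * (r * |z.im|))) * Real.exp (π * (1 - r) * |z.im|) := by gcongr
    _ = C * (r * |z.im| + 1) ^ m * Real.exp (π * |z.im|) := by
        rw [mul_assoc, mul_assoc, ← Real.exp_add, ← mul_assoc]; congr 2; ring
    _ ≤ C * (D * Real.exp (ε * |z.im|)) * Real.exp (π * |z.im|) := by
        gcongr
        exact h4.trans (h2 _ (abs_nonneg _))
    _ = C * D * Real.exp ((π + ε) * |z.im|) := by
        rw [add_mul, Real.exp_add]; ring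
    _ ≤ _ := by
        gcongr
        exact Complex.abs_im_le_norm z

theorem gapp_Lp {p : ℝ} (hp0 : 0 < p) {f : ℂ → ℂ} (hf : Differentiable ℂ f) (hZ : ZNorm p f < ⊤)
    {n : ℕ} (hn : 0 < n) (hnp : 2 ≤ n * p) {r : ℝ} (hr : r < 1) :
    (∫⁻ x : ℝ, (‖gapp f n r x‖₊ : ℝ≥0∞) ^ p) < ⊤ := by
  obtain ⟨C, hC, m, h⟩ := growth hp0 hf hZ
  have hn' : (0:ℝ) < n := by exact_mod_cast hn
  set c := π * (1 - r) / n with hc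
  have hc0 : 0 < c := by
    have : 0 < 1 - r := by linarith
    positivity
  simp_rw [nnnorm_rpow_eq hp0.le]
  have hb : ∀ x : ℝ, ‖gapp f n r x‖ ^ p ≤ C ^ p * (2 * (1 + (x * c) ^ 2)⁻¹) := by
    intro x
    have h1 := h (r * x)
    rw [← Complex.ofReal_mul, Complex.ofReal_im] at h1
    simp only [abs_zero, zero_add, one_pow, mul_zero, Real.exp_zero, mul_one] at h1
    have h2 : ‖csinc ((c:ℂ) * x)‖ ≤ 1 := by
      simpa using norm_csinc_le ((c:ℂ) * x)
    have h3 := norm_csinc_real (c * x)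
    push_cast at h3
    unfold gapp
    rw [norm_mul, norm_pow, Real.mul_rpow (by positivity) (by positivity), ← hc]
    gcongr
    · push_cast at h1; exact h1
    · rw [mul_comm x]
      refine le_trans ?_ h3
      rw [← Real.rpow_natCast, ← Real.rpow_natCast, ← Real.rpow_mul (norm_nonneg _)]
      exact Real.rpow_le_rpow_of_exponent_ge_of_imp (norm_nonneg _) h2 (by exact_mod_cast hnp) (by
        intro _ h0; exfalso; norm_num at h0; rcases h0 with h0 | h0 <;> [omega; linarith])
  refine lt_of_le_of_lt (lintegral_mono fun x => ENNReal.ofReal_le_ofReal (hb x)) ?_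
  have : Integrable (fun x : ℝ => C ^ p * (2 * (1 + (x * c) ^ 2)⁻¹)) :=
    ((integrable_inv_one_add_sq.comp_mul_right' hc0.ne').const_mul 2).const_mul _
  exact this.lintegral_lt_top

/-- Generalized dominated convergence. -/
theorem gdct {h Gj : ℕ → ℂ → ℝ≥0∞} {G : ℂ → ℝ≥0∞} (hh : ∀ j, Measurable (h j))
    (hGj : ∀ j, Measurable (Gj j)) (hG : Measurable G) (hfin : ∫⁻ z, G z ≠ ⊤)
    (hle : ∀ j z, h j z ≤ G z + Gj j z)
    (hlim : ∀ z, Filter.Tendsto (fun j => h j z) Filter.atTop (nhds 0))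
    (hlimG : ∀ z, Filter.Tendsto (fun j => Gj j z) Filter.atTop (nhds (G z)))
    (hconv_int : Filter.Tendsto (fun j => ∫⁻ z, Gj j z) Filter.atTop (nhds (∫⁻ z, G z))) :
    Filter.Tendsto (fun j => ∫⁻ z, h j z) Filter.atTop (nhds 0) := by
  have h1 : Filter.Tendsto (fun j => ∫⁻ z, min (h j z) (2 * G z)) Filter.atTop (nhds (∫⁻ z : ℂ, 0)) := by
    apply tendsto_lintegral_of_dominated_convergence (fun z => 2 * G z)
    · intro j; exact (hh j).min (hG.const_mul 2)
    · intro j; filter_upwards with z; exact min_le_right _ _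
    · rw [lintegral_const_mul _ hG]; exact ENNReal.mul_ne_top (by norm_num) hfin
    · filter_upwards with z
      have := (hlim z).min (tendsto_const_nhds (x := 2 * G z))
      simpa using this
  have h2 : Filter.Tendsto (fun j => ∫⁻ z, min (Gj j z) (G z)) Filter.atTop (nhds (∫⁻ z : ℂ, G z)) := by
    apply tendsto_lintegral_of_dominated_convergence G
    · intro j; exact (hGj j).min hG
    · intro j; filter_upwards with z; exact min_le_right _ _
    · exact hfin
    · filter_upwards with z
      have := (hlimG z).min (tendsto_const_nhds (x := G z))
      simpa using this
  have hmf : ∀ j, ∫⁻ z, min (Gj j z) (G z) ≠ ⊤ := fun j =>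
    ne_top_of_le_ne_top hfin (lintegral_mono fun z => min_le_right _ _)
  have h3 : ∀ j, ∫⁻ z, (Gj j z - G z) = (∫⁻ z, Gj j z) - ∫⁻ z, min (Gj j z) (G z) := by
    intro j
    apply ENNReal.eq_sub_of_add_eq (hmf j)
    rw [← lintegral_add_right _ ((hGj j).min hG)]
    congr 1; ext z
    exact tsub_add_min
  have h4 : Filter.Tendsto (fun j => ∫⁻ z, (Gj j z - G z)) Filter.atTop (nhds 0) := by
    simp_rw [h3]
    have := ENNReal.Tendsto.sub hconv_int h2 (Or.inl hfin)
    simpa using this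
  have h5 := h1.add h4
  rw [lintegral_zero, zero_add] at h5
  refine tendsto_of_tendsto_of_tendsto_of_le_of_le tendsto_const_nhds h5 (fun _ => by simp) (fun j => ?_)
  simp only
  rw [← lintegral_add_left ((hh j).min (hG.const_mul 2))]
  apply lintegral_mono
  intro z
  simp only
  rcases le_total (h j z) (2 * G z) with hc | hc
  · rw [min_eq_left hc]; exact le_self_add
  · rw [min_eq_right hc]
    refine (hle j z).trans ?_
    rw [two_mul, add_assoc]
    gcongr
    exact le_add_tsub

theorem dil_int (G : ℂ → ℝ≥0∞) (hG : Measurable G) {r : ℝ} (hr : 0 < r) :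
    ∫⁻ z, G (r * z) = ENNReal.ofReal (r ^ 2)⁻¹ * ∫⁻ z, G z := by
  have h := Measure.map_addHaar_smul (volume : Measure ℂ) hr.ne'
  have h2 : ∫⁻ z, G (r * z) = ∫⁻ z, G z ∂(Measure.map (r • ·) (volume : Measure ℂ)) := by
    rw [lintegral_map hG (measurable_const_smul r)]
    simp
  rw [h2, h, lintegral_smul_measure, Complex.finrank_real_complex, abs_of_pos (by positivity), smul_eq_mul]

theorem part2 {p : ℝ} (hp0 : 0 < p) {f : ℂ → ℂ} (hf : Differentiable ℂ f) (hZ : ZNorm p f < ⊤)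
    {ε : ℝ} (hε : 0 < ε) : ∃ g : ℂ → ℂ, ExpTypePi g ∧
        (∫⁻ x : ℝ, (‖g x‖₊ : ℝ≥0∞) ^ p) < ⊤ ∧
        ZNorm p (fun z => f z - g z) < ENNReal.ofReal ε := by
  obtain ⟨n, hn2⟩ := exists_nat_ge (2 / p)
  have hnp : 2 ≤ n * p := by rwa [div_le_iff₀ hp0] at hn2
  have hn : 0 < n := by
    rcases Nat.eq_zero_or_pos n with h | h
    · rw [h] at hnp; norm_num at hnp
    · exact h
  set α := 1 / p - 2 with hα
  set r : ℕ → ℝ := fun j => 1 - 1 / ((j:ℝ) + 2) with hr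
  have hr1 : ∀ j, r j < 1 := fun j => by
    have : (0:ℝ) < 1 / ((j:ℝ) + 2) := by positivity
    simp only [hr]; linarith
  have hr0 : ∀ j, 0 < r j := fun j => by
    have : 1 / ((j:ℝ) + 2) < 1 := by
      rw [div_lt_one (by positivity)]
      have : (0:ℝ) ≤ j := by positivity
      linarith
    simp only [hr]; linarith
  have hrt : Filter.Tendsto r Filter.atTop (nhds 1) := by
    have h1 : Filter.Tendsto (fun j : ℕ => 1 / ((j:ℝ) + 2)) Filter.atTop (nhds 0) := by
      have := tendsto_one_div_add_atTop_nhds_zero_nat (𝕜 := ℝ)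
      have h2 := (Filter.tendsto_add_atTop_iff_nat 1).mpr this
      refine h2.congr (fun j => ?_)
      push_cast; ring
    have := (tendsto_const_nhds (x := (1:ℝ))).sub h1
    rw [sub_zero] at this
    exact this
  have hfc := hf.continuous
  have hen : ∀ w : ℂ, (‖w‖₊ : ℝ≥0∞) = ENNReal.ofReal ‖w‖ := fun w => by
    rw [ofReal_norm]; rfl
  set G : ℂ → ℝ≥0∞ := (fun z : ℂ => ENNReal.ofReal
      (Real.exp (-Real.pi * |z.im|) * |z.im| ^ α) * (‖f z‖₊ : ℝ≥0∞)) with hG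
  have hGm : Measurable G := W_meas hf.continuous
  set Gj : ℕ → ℂ → ℝ≥0∞ := fun j z => ENNReal.ofReal
      (Real.exp (-Real.pi * (r j * |z.im|)) * |z.im| ^ α) * (‖f (r j * z)‖₊ : ℝ≥0∞) with hGj
  have hGjm : ∀ j, Measurable (Gj j) := by
    intro j
    have : Measurable (fun z : ℂ => f (r j * z)) := by
      apply Continuous.measurable; fun_prop
    simp only [hGj]
    fun_prop
  have hGjG : ∀ j z, Gj j z = ENNReal.ofReal (r j ^ (-α)) * G (r j * z) := by
    intro j z
    simp only [hGj, hG]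
    rw [← mul_assoc (ENNReal.ofReal (r j ^ (-α))), ← ENNReal.ofReal_mul (Real.rpow_nonneg (hr0 j).le _), Complex.im_ofReal_mul, abs_mul,
      abs_of_pos (hr0 j), Real.mul_rpow (hr0 j).le (abs_nonneg _)]
    congr 2
    have : r j ^ (-α) * r j ^ α = 1 := by
      rw [← Real.rpow_add (hr0 j)]; simp
    linear_combination (-(Real.exp (-π * (r j * |z.im|)) * |z.im| ^ α)) * this
  have key := gdct (h := fun j z => ENNReal.ofReal
      (Real.exp (-Real.pi * |z.im|) * |z.im| ^ α) * (‖f z - gapp f n (r j) z‖₊ : ℝ≥0∞))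
      (Gj := Gj) (G := G) (fun j => W_meas (hfc.sub (gapp_diff hf n (r j)).continuous)) hGjm hGm hZ.ne
      ?_ ?_ ?_ ?_
  · have h1 := (key.eventually_lt_const (show (0:ℝ≥0∞) < ENNReal.ofReal ε by simpa using hε)).exists
    obtain ⟨j, hj⟩ := h1
    exact ⟨gapp f n (r j), gapp_exp hp0 hf hZ hn (hr0 j) (hr1 j), gapp_Lp hp0 hf hZ hn hnp (hr1 j), hj⟩
  · intro j z
    simp only [hG, hGj]
    have h1 : (‖f z - gapp f n (r j) z‖₊ : ℝ≥0∞) ≤ ‖f z‖₊ + ‖gapp f n (r j) z‖₊ := by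
      exact_mod_cast nnnorm_sub_le _ _
    refine (mul_le_mul' le_rfl h1).trans ?_
    rw [mul_add]
    refine add_le_add le_rfl ?_
    rw [hen, hen, ← ENNReal.ofReal_mul (by positivity), ← ENNReal.ofReal_mul (by positivity)]
    apply ENNReal.ofReal_le_ofReal
    calc _ ≤ Real.exp (-π * |z.im|) * |z.im| ^ α * (‖f (r j * z)‖ * Real.exp (π * (1 - r j) * |z.im|)) := by
          gcongr
          exact gapp_bound f hn (hr1 j) z
      _ = (Real.exp (-π * |z.im|) * Real.exp (π * (1 - r j) * |z.im|)) * |z.im| ^ α * ‖f (r j * z)‖ := by ring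
      _ = _ := by rw [← Real.exp_add]; congr 3; ring
  · intro z
    have h1 : Filter.Tendsto (fun j => gapp f n (r j) z) Filter.atTop (nhds (gapp f n 1 z)) := by
      have : Continuous (fun s : ℝ => gapp f n s z) := by
        unfold gapp
        have := csinc_diff.continuous
        fun_prop
      exact (this.tendsto 1).comp hrt
    have h2 : gapp f n 1 z = f z := by
      simp [gapp, csinc_zero]
    rw [h2] at h1
    have h3 : Filter.Tendsto (fun j => (‖f z - gapp f n (r j) z‖₊ : ℝ≥0∞)) Filter.atTop (nhds 0) := by
      have := ((tendsto_const_nhds (x := f z)).sub h1).nnnorm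
      rw [sub_self, nnnorm_zero] at this
      have h := ENNReal.tendsto_coe.mpr this
      rwa [ENNReal.coe_zero] at h
    have h4 := ENNReal.Tendsto.const_mul (a := ENNReal.ofReal
      (Real.exp (-Real.pi * |z.im|) * |z.im| ^ α)) h3 (Or.inr ENNReal.ofReal_ne_top)
    rwa [mul_zero] at h4
  · intro z
    simp only [hG, hGj, hen]
    simp_rw [← ENNReal.ofReal_mul (by positivity : 0 ≤ Real.exp (-Real.pi * |z.im|) * |z.im| ^ α)]
    have h1 : Continuous (fun s : ℝ => Real.exp (-Real.pi * (s * |z.im|)) * |z.im| ^ α * ‖f (s * z)‖) := by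
      fun_prop
    have h2 := ENNReal.tendsto_ofReal ((h1.tendsto 1).comp hrt)
    simp only [one_mul, Complex.ofReal_one] at h2
    refine h2.congr (fun j => ?_)
    simp only [Function.comp]
    rw [← ENNReal.ofReal_mul (by positivity)]
  · simp_rw [hGjG]
    have h1 : ∀ j, ∫⁻ z : ℂ, ENNReal.ofReal (r j ^ (-α)) * G (r j * z) =
        ENNReal.ofReal (r j ^ (-α) * (r j ^ 2)⁻¹) * ∫⁻ z, G z := by
      intro j
      rw [lintegral_const_mul' _ _ ENNReal.ofReal_ne_top, dil_int G hGm (hr0 j), ← mul_assoc,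
        ← ENNReal.ofReal_mul (Real.rpow_nonneg (hr0 j).le _)]
    simp_rw [h1]
    have h2 : Filter.Tendsto (fun j => r j ^ (-α) * (r j ^ 2)⁻¹) Filter.atTop (nhds 1) := by
      have h3 := hrt.rpow_const (p := -α) (Or.inl one_ne_zero)
      have h4 := (hrt.pow 2).inv₀ (by norm_num)
      simpa using h3.mul h4
    have h5 := ENNReal.Tendsto.mul_const (b := ∫⁻ z, G z) (ENNReal.tendsto_ofReal h2) (Or.inr hZ.ne)
    simpa using h5

/-- For `0 < p < 1`, `Eᵖ ⊆ Z` and `Eᵖ` is dense in `Z`, where `Z` is the space of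
entire functions with finite norm `∫_ℂ e^{-π|Im z|} |Im z|^{1/p-2} |f(z)| dA(z)`. -/
theorem Ep_subset_dense_in_Z (p : ℝ) (hp0 : 0 < p) (hp1 : p < 1) :
    (∀ f : ℂ → ℂ, ExpTypePi f → (∫⁻ x : ℝ, (‖f x‖₊ : ℝ≥0∞) ^ p) < ⊤ →
      ZNorm p f < ⊤) ∧
    (∀ f : ℂ → ℂ, Differentiable ℂ f → ZNorm p f < ⊤ →
      ∀ ε : ℝ, 0 < ε → ∃ g : ℂ → ℂ, ExpTypePi g ∧
        (∫⁻ x : ℝ, (‖g x‖₊ : ℝ≥0∞) ^ p) < ⊤ ∧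
        ZNorm p (fun z => f z - g z) < ENNReal.ofReal ε) := by
  exact ⟨fun f hf hi => part1 hp0 hp1 hf hi, fun f hf hZ ε hε => part2 hp0 hf hZ hε⟩
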